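/- arXiv:1509.00370 — 6 statements merged into one kernel-verified Lean document; each statement's English description precedes it below -/
import Mathlib

section
/- Let n₁, n₂ ≥ 1 and let G be a finite tree. Then CB(n₁,n₂) is friendly to G if and only if |E(G)| = n₁ + n₂ − 1 and there exist two subtrees H₁ and H₂ of G whose edge sets intersect in exactly one edge and satisfy |E(H₁)| = n₁ and |E(H₂)| = n₂. -/
open SimpleGraph

/-- `p` does not catch `q` in `G`: they are disjoint and for any two distinct edges of `p`,
the path in `G` between them contains an even number of edges of `q`. -/
def DoesNotCatch {V : Type*} (G : SimpleGraph V) (p q : Set (Sym2 V)) : Prop :=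
  p ∩ q = ∅ ∧
    ∀ e ∈ p, ∀ f ∈ p, e ≠ f →
      ∀ (u v : V) (w : G.Walk u v), w.IsPath → u ∈ e → v ∈ f →
        e ∉ w.edges → f ∉ w.edges →
        Even (w.edges.countP (fun x => @decide (x ∈ q) (Classical.propDecidable _)))

/-- `p` and `q` are unlinked in `G`. -/
def Unlinked {V : Type*} (G : SimpleGraph V) (p q : Set (Sym2 V)) : Prop :=
  DoesNotCatch G p q ∧ DoesNotCatch G q p

/-- Image of a set of edges of `G₁` under a map of edge sets. -/
def edgeImage {V₁ V₂ : Type*} {G₁ : SimpleGraph V₁} {G₂ : SimpleGraph V₂}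
    (φ : G₁.edgeSet → G₂.edgeSet) (s : Set (Sym2 V₁)) : Set (Sym2 V₂) :=
  {e₂ | ∃ e₁ : G₁.edgeSet, (e₁ : Sym2 V₁) ∈ s ∧ (φ e₁ : Sym2 V₂) = e₂}

/-- A bijection of edge sets is friendly if the images of the coboundaries (incidence sets)
of any two distinct vertices at even distance are unlinked. -/
def FriendlyBij {V₁ V₂ : Type*} (G₁ : SimpleGraph V₁) (G₂ : SimpleGraph V₂)
    (φ : G₁.edgeSet ≃ G₂.edgeSet) : Prop :=
  ∀ P Q : V₁, P ≠ Q → Even (G₁.dist P Q) →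
    Unlinked G₂ (edgeImage φ (G₁.incidenceSet P)) (edgeImage φ (G₁.incidenceSet Q))

/-- `G₁` is friendly to `G₂`. -/
def Friendly {V₁ V₂ : Type*} (G₁ : SimpleGraph V₁) (G₂ : SimpleGraph V₂) : Prop :=
  ∃ φ : G₁.edgeSet ≃ G₂.edgeSet, FriendlyBij G₁ G₂ φ

/-- The tree `CB n₁ n₂`: two adjacent centers `0` and `1` of degrees `n₁` and `n₂`,
all other vertices being leaves. -/
def CB (n₁ n₂ : ℕ) : SimpleGraph (Fin (n₁ + n₂)) :=
  SimpleGraph.fromRel (fun a b =>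
    (a.val = 0 ∧ b.val = 1) ∨ (a.val = 0 ∧ 2 ≤ b.val ∧ b.val ≤ n₁) ∨
    (a.val = 1 ∧ n₁ + 1 ≤ b.val))

/-- The subgraph of `G` spanned by the edge set `F` is connected: any two of its vertices
are joined by a walk using only edges of `F`. -/
def SpannedConnected {V : Type*} (G : SimpleGraph V) (F : Set (Sym2 V)) : Prop :=
  ∀ x y : V, (∃ e ∈ F, x ∈ e) → (∃ e ∈ F, y ∈ e) →
    ∃ w : G.Walk x y, ∀ e ∈ w.edges, e ∈ F

/-- The part of a path starting at an end of `e` that lies beyond `e`. -/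
theorem SimpleGraph.Walk.IsPath.exists_avoiding_edge {V : Type*} {G : SimpleGraph V} {u v : V}
    {w : G.Walk u v} (hw : w.IsPath) {e : Sym2 V} (he : u ∈ e) :
    ∃ (u' : V) (w' : G.Walk u' v), w'.IsPath ∧ u' ∈ e ∧ e ∉ w'.edges ∧
      w'.edges ⊆ w.edges ∧ w.edges ⊆ e :: w'.edges := by
  classical
  by_cases hmem : e ∈ w.edges
  · cases w with
    | nil => simp at hmem
    | @cons _ x _ h w' =>
      rw [Walk.cons_isPath_iff] at hw
      have hnot : e ∉ w'.edges := fun h' => hw.2 (Walk.mem_support_of_mem_edges h' he)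
      have hex : e = s(u, x) := by simpa [hnot] using hmem
      exact ⟨x, w', hw.1, by simp [hex], hnot, by simp, by simp [hex]⟩
  · exact ⟨u, w, hw, he, hmem, by simp, by simp⟩

theorem SpannedConnected.doesNotCatch {V : Type*} {G : SimpleGraph V} (hG : G.IsAcyclic)
    {p q : Set (Sym2 V)} (hp : SpannedConnected G p) (hpq : p ∩ q = ∅) :
    DoesNotCatch G p q := by
  classical
  refine ⟨hpq, fun e he f hf _ u v w hw hu hv _ _ => ?_⟩
  obtain ⟨w', hw'⟩ := hp u v ⟨e, he, hu⟩ ⟨f, hf, hv⟩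
  have heq : w = w'.bypass :=
    congrArg Subtype.val <| (hG.subsingleton_path u v).elim ⟨w, hw⟩ ⟨w'.bypass, w'.bypass_isPath⟩
  have hzero : w.edges.countP
      (fun x => @decide (x ∈ q) (Classical.propDecidable _)) = 0 := by
    rw [List.countP_eq_zero]
    intro x hx hxq
    rw [heq] at hx
    have hxp := hw' x (w'.edges_bypass_subset_edges hx)
    have : x ∈ p ∩ q := ⟨hxp, by simpa using hxq⟩
    simp [hpq] at this
  simp [hzero]

theorem DoesNotCatch.notMem_edges {V : Type*} {G : SimpleGraph V} {p : Set (Sym2 V)}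
    {b : Sym2 V} (h : DoesNotCatch G p {b}) {e f : Sym2 V} (he : e ∈ p) (hf : f ∈ p)
    (hef : e ≠ f) {u v : V} {w : G.Walk u v} (hw : w.IsPath) (hu : u ∈ e) (hv : v ∈ f)
    (hew : e ∉ w.edges) (hfw : f ∉ w.edges) : b ∉ w.edges := by
  classical
  intro hb
  have heven := h.2 e he f hf hef u v w hw hu hv hew hfw
  have hcount : w.edges.countP
      (fun x => @decide (x ∈ ({b} : Set (Sym2 V))) (Classical.propDecidable _)) =
        w.edges.count b := by
    rw [List.count]
    refine List.countP_congr fun x _ => ?_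
    simp
  rw [hcount, List.count_eq_one_of_mem hw.isTrail.edges_nodup hb] at heven
  exact absurd heven (by decide)

theorem spannedConnected_of_doesNotCatch {V : Type*} {G : SimpleGraph V} (hG : G.Connected)
    {p : Set (Sym2 V)} (hpG : p ⊆ G.edgeSet)
    (h : ∀ b ∈ G.edgeSet, b ∉ p → DoesNotCatch G p {b}) : SpannedConnected G p := by
  rintro x y ⟨e, he, hx⟩ ⟨f, hf, hy⟩
  by_cases hef : e = f
  · subst hef
    by_cases hxy : x = y
    · subst hxy
      exact ⟨.nil, by simp⟩
    · obtain rfl := (Sym2.mem_and_mem_iff hxy).1 ⟨hx, hy⟩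
      exact ⟨(show G.Adj x y from hpG he).toWalk, by simpa using he⟩
  obtain ⟨w, hw⟩ := (hG x y).exists_isPath
  refine ⟨w, fun g hg => ?_⟩
  obtain ⟨u, w₁, hw₁, hu, heu, -, hsub₁⟩ := hw.exists_avoiding_edge hx
  obtain ⟨v, w₂, hw₂, hv, hfv, hsub₂, hsub₂'⟩ := hw₁.reverse.exists_avoiding_edge hy
  have hmem : g = e ∨ g = f ∨ g ∈ w₂.edges := by
    rcases List.mem_cons.1 (hsub₁ hg) with rfl | hg₁
    · exact .inl rfl
    · exact .inr (List.mem_cons.1 (hsub₂' (by simpa using hg₁)))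
  rcases hmem with rfl | rfl | hg₂
  · exact he
  · exact hf
  have hew₂ : e ∉ w₂.edges := fun h' => heu (by simpa using hsub₂ h')
  by_contra hgp
  exact (h g (w.edges_subset_edgeSet hg) hgp).notMem_edges hf he (Ne.symm hef) hw₂ hv hu hfv
    hew₂ hg₂

theorem ncard_preimage_coe_edgeSet {V : Type*} (G : SimpleGraph V) {s : Set (Sym2 V)}
    (hs : s ⊆ G.edgeSet) : (Subtype.val ⁻¹' s : Set G.edgeSet).ncard = s.ncard :=
  Set.ncard_preimage_of_injective_subset_range Subtype.val_injective (by simpa using hs)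

section EdgeImage

variable {V₁ V₂ : Type*} {G₁ : SimpleGraph V₁} {G₂ : SimpleGraph V₂}

theorem coe_mem_edgeImage {φ : G₁.edgeSet ≃ G₂.edgeSet} {s : Set (Sym2 V₁)} {e : G₁.edgeSet} :
    (φ e : Sym2 V₂) ∈ edgeImage φ s ↔ (e : Sym2 V₁) ∈ s := by
  constructor
  · rintro ⟨e', he', h⟩
    rwa [← φ.injective (Subtype.ext h)]
  · exact fun h => ⟨e, h, rfl⟩

theorem edgeImage_subset (φ : G₁.edgeSet → G₂.edgeSet) (s : Set (Sym2 V₁)) :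
    edgeImage φ s ⊆ G₂.edgeSet := by
  rintro _ ⟨e, -, rfl⟩
  exact (φ e).2

theorem edgeImage_inter (φ : G₁.edgeSet ≃ G₂.edgeSet) (s t : Set (Sym2 V₁)) :
    edgeImage φ (s ∩ t) = edgeImage φ s ∩ edgeImage φ t := by
  ext e
  constructor
  · rintro ⟨e, he, rfl⟩
    exact ⟨⟨e, he.1, rfl⟩, ⟨e, he.2, rfl⟩⟩
  · rintro ⟨⟨e, he, rfl⟩, h⟩
    exact ⟨e, ⟨he, coe_mem_edgeImage.1 h⟩, rfl⟩

theorem ncard_edgeImage (φ : G₁.edgeSet ≃ G₂.edgeSet) {s : Set (Sym2 V₁)}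
    (hs : s ⊆ G₁.edgeSet) : (edgeImage φ s).ncard = s.ncard := by
  have h : edgeImage φ s = (fun e => (φ e : Sym2 V₂)) '' (Subtype.val ⁻¹' s) := rfl
  have hinj : Function.Injective fun e => (φ e : Sym2 V₂) :=
    Subtype.val_injective.comp φ.injective
  rw [h, Set.ncard_image_of_injective _ hinj, ncard_preimage_coe_edgeSet _ hs]

theorem FriendlyBij.spannedConnected {φ : G₁.edgeSet ≃ G₂.edgeSet} (hφ : FriendlyBij G₁ G₂ φ)
    (hG : G₂.Connected) {P : V₁}
    (hP : ∀ e ∈ G₁.edgeSet, P ∉ e →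
      ∃ Q, P ≠ Q ∧ Even (G₁.dist P Q) ∧ G₁.incidenceSet Q = {e}) :
    SpannedConnected G₂ (edgeImage φ (G₁.incidenceSet P)) := by
  refine spannedConnected_of_doesNotCatch hG (edgeImage_subset _ _) fun b hb hbP => ?_
  obtain ⟨e, he⟩ := φ.surjective ⟨b, hb⟩
  obtain rfl : (φ e : Sym2 V₂) = b := congrArg Subtype.val he
  rw [coe_mem_edgeImage] at hbP
  obtain ⟨Q, hPQ, hdist, hQ⟩ := hP e e.2 fun h => hbP ⟨e.2, h⟩
  have hcatch := (hφ P Q hPQ hdist).1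
  rw [hQ] at hcatch
  have himage : edgeImage φ {(e : Sym2 V₁)} = {(φ e : Sym2 V₂)} := by
    ext x
    simp [edgeImage, eq_comm]
  rwa [himage] at hcatch

theorem friendlyBij_of_spannedConnected {φ : G₁.edgeSet ≃ G₂.edgeSet} (hG : G₂.IsAcyclic)
    (h : ∀ P, SpannedConnected G₂ (edgeImage φ (G₁.incidenceSet P))) : FriendlyBij G₁ G₂ φ := by
  intro P Q hPQ hdist
  have hadj : ¬G₁.Adj P Q := fun hadj => by
    rw [dist_eq_one_iff_adj.2 hadj] at hdist
    exact absurd hdist (by decide)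
  have hdisj : edgeImage φ (G₁.incidenceSet P) ∩ edgeImage φ (G₁.incidenceSet Q) = ∅ := by
    rw [← edgeImage_inter, G₁.incidenceSet_inter_incidenceSet_of_not_adj hadj hPQ]
    simp [edgeImage]
  exact ⟨(h P).doesNotCatch hG hdisj, (h Q).doesNotCatch hG (by rwa [Set.inter_comm])⟩

end EdgeImage

theorem spannedConnected_of_subsingleton {V : Type*} {G : SimpleGraph V} (hG : G.Connected)
    {p : Set (Sym2 V)} (hpG : p ⊆ G.edgeSet) (hp : p.Subsingleton) : SpannedConnected G p :=
  spannedConnected_of_doesNotCatch hG hpG fun _ _ hb =>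
    ⟨by simpa using hb, fun _ he _ hf hef => absurd (hp he hf) hef⟩

/-- Two pairs of subsets with the same intersection pattern are related by a bijection. -/
theorem exists_equiv_of_ncard_eq {α β : Type*} [Finite α] [Finite β] {S T : Set α}
    {S' T' : Set β} (hS : S.ncard = S'.ncard) (hT : T.ncard = T'.ncard)
    (hST : (S ∩ T).ncard = (S' ∩ T').ncard) (hcard : Nat.card α = Nat.card β) :
    ∃ e : α ≃ β, ∀ x, (e x ∈ S' ↔ x ∈ S) ∧ (e x ∈ T' ↔ x ∈ T) := by
  have hdS := Set.ncard_inter_add_ncard_sdiff_eq_ncard S T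
  have hdS' := Set.ncard_inter_add_ncard_sdiff_eq_ncard S' T'
  have hdT := Set.ncard_inter_add_ncard_sdiff_eq_ncard T S
  have hdT' := Set.ncard_inter_add_ncard_sdiff_eq_ncard T' S'
  have hU := Set.ncard_union_add_ncard_inter S T
  have hU' := Set.ncard_union_add_ncard_inter S' T'
  have hC := Set.ncard_add_ncard_compl (S ∪ T)
  have hC' := Set.ncard_add_ncard_compl (S' ∪ T')
  rw [Set.inter_comm] at hdT hdT'
  have hfib (c : Prop × Prop) :
      Nonempty ({x // (x ∈ S, x ∈ T) = c} ≃ {y // (y ∈ S', y ∈ T') = c}) := by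
    refine Finite.card_eq.1 ?_
    change Set.ncard {x | (x ∈ S, x ∈ T) = c} = Set.ncard {y | (y ∈ S', y ∈ T') = c}
    obtain ⟨c₁, c₂⟩ := c
    by_cases h₁ : c₁ <;> by_cases h₂ : c₂ <;> simp only [Prod.mk.injEq, h₁, h₂, eq_iff_iff,
      iff_true, iff_false]
    · exact hST
    · change (S \ T).ncard = (S' \ T').ncard
      omega
    · have h : (T \ S).ncard = (T' \ S').ncard := by omega
      rw [Set.sdiff_eq, Set.sdiff_eq, Set.inter_comm, Set.inter_comm T'] at h
      exact h
    · have h : (S ∪ T)ᶜ.ncard = (S' ∪ T')ᶜ.ncard := by omega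
      rw [Set.compl_union, Set.compl_union] at h
      exact h
  refine ⟨Equiv.ofFiberEquiv fun c => (hfib c).some, fun x => ?_⟩
  have h := Equiv.ofFiberEquiv_map (fun c => (hfib c).some) x
  simpa only [Prod.mk.injEq, eq_iff_iff] using h

theorem exists_edgeEquiv {V₁ V₂ : Type*} [Finite V₁] [Finite V₂] {G₁ : SimpleGraph V₁}
    {G₂ : SimpleGraph V₂} {S T : Set (Sym2 V₁)} {S' T' : Set (Sym2 V₂)}
    (hSG : S ⊆ G₁.edgeSet) (hTG : T ⊆ G₁.edgeSet) (hSG' : S' ⊆ G₂.edgeSet)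
    (hTG' : T' ⊆ G₂.edgeSet) (hS : S.ncard = S'.ncard) (hT : T.ncard = T'.ncard)
    (hST : (S ∩ T).ncard = (S' ∩ T').ncard) (hcard : G₁.edgeSet.ncard = G₂.edgeSet.ncard) :
    ∃ φ : G₁.edgeSet ≃ G₂.edgeSet, edgeImage φ S = S' ∧ edgeImage φ T = T' := by
  obtain ⟨φ, hφ⟩ := exists_equiv_of_ncard_eq (α := G₁.edgeSet) (β := G₂.edgeSet)
    (S := Subtype.val ⁻¹' S) (T := Subtype.val ⁻¹' T)
    (S' := Subtype.val ⁻¹' S') (T' := Subtype.val ⁻¹' T')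
    (by rw [ncard_preimage_coe_edgeSet _ hSG, ncard_preimage_coe_edgeSet _ hSG', hS])
    (by rw [ncard_preimage_coe_edgeSet _ hTG, ncard_preimage_coe_edgeSet _ hTG', hT])
    (by rw [← Set.preimage_inter, ← Set.preimage_inter,
      ncard_preimage_coe_edgeSet _ (fun _ h => hSG h.1),
      ncard_preimage_coe_edgeSet _ (fun _ h => hSG' h.1), hST]) hcard
  have himage {s : Set (Sym2 V₁)} {s' : Set (Sym2 V₂)} (hs' : s' ⊆ G₂.edgeSet)
      (h : ∀ x, (φ x : Sym2 V₂) ∈ s' ↔ (x : Sym2 V₁) ∈ s) : edgeImage φ s = s' := by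
    ext y
    constructor
    · rintro ⟨x, hx, rfl⟩
      exact (h x).2 hx
    · intro hy
      obtain ⟨x, hx⟩ := φ.surjective ⟨y, hs' hy⟩
      obtain rfl : (φ x : Sym2 V₂) = y := congrArg Subtype.val hx
      exact ⟨x, (h x).1 hy, rfl⟩
  exact ⟨φ, himage hSG' fun x => (hφ x).1, himage hTG' fun x => (hφ x).2⟩

theorem incidenceSet_eq_singleton_of_adj_iff {V : Type*} {G : SimpleGraph V} {v c : V}
    (h : ∀ y, G.Adj v y ↔ y = c) : G.incidenceSet v = {s(c, v)} := by
  ext e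
  constructor
  · rintro ⟨he, hv⟩
    obtain ⟨y, rfl⟩ := hv
    simp [(h y).1 he, Sym2.eq_swap]
  · rintro rfl
    exact ⟨((h c).2 rfl).symm, by simp⟩

theorem ncard_incidenceSet {V : Type*} (G : SimpleGraph V) (v : V) :
    (G.incidenceSet v).ncard = (G.neighborSet v).ncard := by
  classical
  exact Nat.card_congr (G.incidenceSetEquivNeighborSet v)

theorem even_dist_of_common_neighbor {V : Type*} {G : SimpleGraph V} {u v w : V}
    (huv : G.Adj u v) (hvw : G.Adj v w) (huw : ¬G.Adj u w) : Even (G.dist u w) := by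
  have hle := dist_le (.cons huv (.cons hvw .nil))
  have hne : G.dist u w ≠ 1 := fun h => huw (dist_eq_one_iff_adj.1 h)
  simp only [Walk.length_cons, Walk.length_nil] at hle
  interval_cases h : G.dist u w <;> simp_all

namespace CB

variable {n₁ n₂ : ℕ}

theorem adj_iff (h₁ : 1 ≤ n₁) {x y : Fin (n₁ + n₂)} : (CB n₁ n₂).Adj x y ↔
    (x.val = 0 ∧ 1 ≤ y.val ∧ y.val ≤ n₁) ∨
      (x.val = 1 ∧ (y.val = 0 ∨ n₁ + 1 ≤ y.val)) ∨
      (y.val = 0 ∧ 1 ≤ x.val ∧ x.val ≤ n₁) ∨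
      (y.val = 1 ∧ n₁ + 1 ≤ x.val) := by
  simp only [CB, fromRel_adj, ne_eq, Fin.ext_iff]
  omega

theorem incidenceSet_leaf_left (h₁ : 1 ≤ n₁) {a v : Fin (n₁ + n₂)} (ha : a.val = 0)
    (hv : 2 ≤ v.val) (hv' : v.val ≤ n₁) : (CB n₁ n₂).incidenceSet v = {s(a, v)} :=
  incidenceSet_eq_singleton_of_adj_iff fun y => by rw [adj_iff h₁, Fin.ext_iff]; omega

theorem incidenceSet_leaf_right (h₁ : 1 ≤ n₁) {b v : Fin (n₁ + n₂)} (hb : b.val = 1)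
    (hv : n₁ + 1 ≤ v.val) : (CB n₁ n₂).incidenceSet v = {s(b, v)} :=
  incidenceSet_eq_singleton_of_adj_iff fun y => by rw [adj_iff h₁, Fin.ext_iff]; omega

theorem exists_leaf_left (h₁ : 1 ≤ n₁) {a b : Fin (n₁ + n₂)} (ha : a.val = 0)
    (hb : b.val = 1) {e : Sym2 (Fin (n₁ + n₂))} (he : e ∈ (CB n₁ n₂).edgeSet) (hbe : b ∉ e) :
    ∃ v : Fin (n₁ + n₂), 2 ≤ v.val ∧ v.val ≤ n₁ ∧ e = s(a, v) := by
  induction e with | _ x y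
  simp only [mem_edgeSet, adj_iff h₁, Sym2.mem_iff, not_or, Fin.ext_iff] at he hbe
  by_cases hx : x = a
  · exact ⟨y, by omega, by omega, by rw [hx]⟩
  · rw [Fin.ext_iff] at hx
    obtain rfl : y = a := Fin.ext (by omega)
    exact ⟨x, by omega, by omega, Sym2.eq_swap⟩

theorem exists_leaf_right (h₁ : 1 ≤ n₁) {a b : Fin (n₁ + n₂)} (ha : a.val = 0)
    (hb : b.val = 1) {e : Sym2 (Fin (n₁ + n₂))} (he : e ∈ (CB n₁ n₂).edgeSet) (hae : a ∉ e) :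
    ∃ v : Fin (n₁ + n₂), n₁ + 1 ≤ v.val ∧ e = s(b, v) := by
  induction e with | _ x y
  simp only [mem_edgeSet, adj_iff h₁, Sym2.mem_iff, not_or, Fin.ext_iff] at he hae
  by_cases hx : x = b
  · exact ⟨y, by omega, by rw [hx]⟩
  · rw [Fin.ext_iff] at hx
    obtain rfl : y = b := Fin.ext (by omega)
    exact ⟨x, by omega, Sym2.eq_swap⟩

theorem edgeSet_eq (h₁ : 1 ≤ n₁) {a b : Fin (n₁ + n₂)} (ha : a.val = 0) (hb : b.val = 1) :
    (CB n₁ n₂).edgeSet = (CB n₁ n₂).incidenceSet a ∪ (CB n₁ n₂).incidenceSet b := by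
  refine Set.Subset.antisymm (fun e he => ?_) (Set.union_subset (fun _ h => h.1) fun _ h => h.1)
  by_cases hae : a ∈ e
  · exact .inl ⟨he, hae⟩
  · obtain ⟨v, -, rfl⟩ := exists_leaf_right h₁ ha hb he hae
    exact .inr ⟨he, by simp⟩

theorem ncard_incidenceSet_left (h₁ : 1 ≤ n₁) (h₂ : 1 ≤ n₂) {a : Fin (n₁ + n₂)}
    (ha : a.val = 0) : ((CB n₁ n₂).incidenceSet a).ncard = n₁ := by
  have hnbr : (CB n₁ n₂).neighborSet a = Fin.val ⁻¹' (Set.Icc 1 n₁) := by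
    ext y
    rw [mem_neighborSet, adj_iff h₁, Set.mem_preimage, Set.mem_Icc]
    omega
  rw [ncard_incidenceSet, hnbr, Set.ncard_preimage_of_injective_subset_range Fin.val_injective]
  · simp [← Finset.coe_Icc, Set.ncard_coe_finset]
  · exact fun k hk => ⟨⟨k, by have := hk.2; omega⟩, rfl⟩

theorem ncard_incidenceSet_right (h₁ : 1 ≤ n₁) (h₂ : 1 ≤ n₂) {b : Fin (n₁ + n₂)}
    (hb : b.val = 1) : ((CB n₁ n₂).incidenceSet b).ncard = n₂ := by
  have hnbr : (CB n₁ n₂).neighborSet b = Fin.val ⁻¹' (insert 0 (Set.Ico (n₁ + 1) (n₁ + n₂))) := by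
    ext y
    rw [mem_neighborSet, adj_iff h₁, Set.mem_preimage, Set.mem_insert_iff, Set.mem_Ico]
    omega
  rw [ncard_incidenceSet, hnbr, Set.ncard_preimage_of_injective_subset_range Fin.val_injective,
    Set.ncard_insert_of_notMem (by simp), ← Finset.coe_Ico, Set.ncard_coe_finset, Nat.card_Ico]
  · omega
  · rintro k (rfl | hk)
    · exact ⟨⟨0, by omega⟩, rfl⟩
    · exact ⟨⟨k, hk.2⟩, rfl⟩

theorem ncard_incidenceSet_inter (h₁ : 1 ≤ n₁) {a b : Fin (n₁ + n₂)} (ha : a.val = 0)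
    (hb : b.val = 1) :
    ((CB n₁ n₂).incidenceSet a ∩ (CB n₁ n₂).incidenceSet b).ncard = 1 := by
  rw [incidenceSet_inter_incidenceSet_of_adj _ ((adj_iff h₁).2 (by omega)), Set.ncard_singleton]

theorem ncard_edgeSet (h₁ : 1 ≤ n₁) (h₂ : 1 ≤ n₂) :
    (CB n₁ n₂).edgeSet.ncard = n₁ + n₂ - 1 := by
  let a : Fin (n₁ + n₂) := ⟨0, by omega⟩
  let b : Fin (n₁ + n₂) := ⟨1, by omega⟩
  have ha : a.val = 0 := rfl
  have hb : b.val = 1 := rfl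
  have h := Set.ncard_union_add_ncard_inter ((CB n₁ n₂).incidenceSet a)
    ((CB n₁ n₂).incidenceSet b)
  rw [← edgeSet_eq h₁ ha hb, ncard_incidenceSet_inter h₁ ha hb,
    ncard_incidenceSet_left h₁ h₂ ha, ncard_incidenceSet_right h₁ h₂ hb] at h
  omega

theorem exists_even_dist_left (h₁ : 1 ≤ n₁) {a b : Fin (n₁ + n₂)} (ha : a.val = 0)
    (hb : b.val = 1) {e : Sym2 (Fin (n₁ + n₂))} (he : e ∈ (CB n₁ n₂).edgeSet) (hae : a ∉ e) :
    ∃ v, a ≠ v ∧ Even ((CB n₁ n₂).dist a v) ∧ (CB n₁ n₂).incidenceSet v = {e} := by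
  obtain ⟨v, hv, rfl⟩ := exists_leaf_right h₁ ha hb he hae
  exact ⟨v, by rw [ne_eq, Fin.ext_iff]; omega,
    even_dist_of_common_neighbor (v := b) ((adj_iff h₁).2 (by omega)) he
      (by rw [adj_iff h₁]; omega),
    incidenceSet_leaf_right h₁ hb hv⟩

theorem exists_even_dist_right (h₁ : 1 ≤ n₁) {a b : Fin (n₁ + n₂)} (ha : a.val = 0)
    (hb : b.val = 1) {e : Sym2 (Fin (n₁ + n₂))} (he : e ∈ (CB n₁ n₂).edgeSet) (hbe : b ∉ e) :
    ∃ v, b ≠ v ∧ Even ((CB n₁ n₂).dist b v) ∧ (CB n₁ n₂).incidenceSet v = {e} := by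
  obtain ⟨v, hv, hv', rfl⟩ := exists_leaf_left h₁ ha hb he hbe
  exact ⟨v, by rw [ne_eq, Fin.ext_iff]; omega,
    even_dist_of_common_neighbor (v := a) ((adj_iff h₁).2 (by omega)) he
      (by rw [adj_iff h₁]; omega),
    incidenceSet_leaf_left h₁ ha hv hv'⟩

theorem subsingleton_incidenceSet (h₁ : 1 ≤ n₁) {v : Fin (n₁ + n₂)} (hv : 2 ≤ v.val) :
    ((CB n₁ n₂).incidenceSet v).Subsingleton := by
  by_cases hv' : v.val ≤ n₁
  · rw [incidenceSet_leaf_left (a := ⟨0, by omega⟩) h₁ rfl hv hv']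
    exact Set.subsingleton_singleton
  · rw [incidenceSet_leaf_right (b := ⟨1, by omega⟩) h₁ rfl (by omega)]
    exact Set.subsingleton_singleton

end CB

/-- **Theorem (criterion of friendliness to a tree of diameter 3).** `CB n₁ n₂` is friendly
to a finite tree `G` iff `|E(G)| = n₁ + n₂ - 1` and `G` contains two subtrees (connected
edge sets) `E₁`, `E₂` with `|E₁| = n₁`, `|E₂| = n₂` meeting in exactly one edge. -/
theorem cb_friendly_iff {V : Type*} [Fintype V] [DecidableEq V]
    (G : SimpleGraph V) [DecidableRel G.Adj] (hT : G.IsTree)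
    (n₁ n₂ : ℕ) (h₁ : 1 ≤ n₁) (h₂ : 1 ≤ n₂) :
    Friendly (CB n₁ n₂) G ↔
      (G.edgeFinset.card = n₁ + n₂ - 1 ∧
        ∃ E₁ E₂ : Finset (Sym2 V), ↑E₁ ⊆ G.edgeSet ∧ ↑E₂ ⊆ G.edgeSet ∧
          (E₁ ∩ E₂).card = 1 ∧ E₁.card = n₁ ∧ E₂.card = n₂ ∧
          SpannedConnected G ↑E₁ ∧ SpannedConnected G ↑E₂) := by
  classical
  let a : Fin (n₁ + n₂) := ⟨0, by omega⟩
  let b : Fin (n₁ + n₂) := ⟨1, by omega⟩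
  have ha : a.val = 0 := rfl
  have hb : b.val = 1 := rfl
  have hedge : G.edgeFinset.card = G.edgeSet.ncard := by
    rw [← coe_edgeFinset, Set.ncard_coe_finset]
  have hsub (v : Fin (n₁ + n₂)) : (CB n₁ n₂).incidenceSet v ⊆ (CB n₁ n₂).edgeSet :=
    fun _ h => h.1
  constructor
  · rintro ⟨φ, hφ⟩
    refine ⟨hedge.trans ((Nat.card_congr φ).symm.trans (CB.ncard_edgeSet h₁ h₂)),
      (edgeImage φ ((CB n₁ n₂).incidenceSet a)).toFinset,
      (edgeImage φ ((CB n₁ n₂).incidenceSet b)).toFinset, ?_⟩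
    simp only [← Set.toFinset_inter, ← Set.ncard_eq_toFinset_card', Set.coe_toFinset,
      ← edgeImage_inter]
    rw [ncard_edgeImage φ (hsub a), ncard_edgeImage φ (hsub b),
      ncard_edgeImage φ (Set.inter_subset_left.trans (hsub a))]
    exact ⟨edgeImage_subset _ _, edgeImage_subset _ _, CB.ncard_incidenceSet_inter h₁ ha hb,
      CB.ncard_incidenceSet_left h₁ h₂ ha, CB.ncard_incidenceSet_right h₁ h₂ hb,
      hφ.spannedConnected hT.connected fun _ => CB.exists_even_dist_left h₁ ha hb,
      hφ.spannedConnected hT.connected fun _ => CB.exists_even_dist_right h₁ ha hb⟩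
  · rintro ⟨hcard, E₁, E₂, hE₁, hE₂, hinter, hcard₁, hcard₂, hconn₁, hconn₂⟩
    obtain ⟨φ, hφa, hφb⟩ := exists_edgeEquiv (hsub a) (hsub b) hE₁ hE₂
      (by rw [CB.ncard_incidenceSet_left h₁ h₂ ha, Set.ncard_coe_finset, hcard₁])
      (by rw [CB.ncard_incidenceSet_right h₁ h₂ hb, Set.ncard_coe_finset, hcard₂])
      (by rw [CB.ncard_incidenceSet_inter h₁ ha hb, ← Finset.coe_inter, Set.ncard_coe_finset,
        hinter])
      (by rw [CB.ncard_edgeSet h₁ h₂, ← hedge, hcard])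
    refine ⟨φ, friendlyBij_of_spannedConnected hT.isAcyclic fun P => ?_⟩
    by_cases hP : 2 ≤ P.val
    · refine spannedConnected_of_subsingleton hT.connected (edgeImage_subset _ _) ?_
      rintro _ ⟨e, he, rfl⟩ _ ⟨f, hf, rfl⟩
      rw [Subtype.ext (CB.subsingleton_incidenceSet h₁ hP he hf)]
    · obtain rfl | rfl : P = a ∨ P = b := by
        simp only [Fin.ext_iff, ha, hb]
        omega
      · rwa [hφa]
      · rwa [hφb]
end

section
/- Let n₁, n₂ ≥ 1, let G be a finite tree, and let φ: E(CB(n₁,n₂)) → E(G) be a friendly bijection. Then the images φ(δC₁) and φ(δC₂) of the coboundaries of the two centers C₁ and C₂ of CB(n₁,n₂) are connected edge sets of G, i.e., for any two edges of φ(δC₁) every edge on the path in G between them belongs to φ(δC₁), and likewise for φ(δC₂). -/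
open SimpleGraph

/-- An edge set `S` of a tree `G` is connected: every edge on the path between any two
edges of `S` belongs to `S`. -/
def EdgeSetConnected {V : Type*} (G : SimpleGraph V) (S : Set (Sym2 V)) : Prop :=
  ∀ e ∈ S, ∀ f ∈ S, e ≠ f →
    ∀ (u v : V) (w : G.Walk u v), w.IsPath → u ∈ e → v ∈ f →
      e ∉ w.edges → f ∉ w.edges → ∀ g ∈ w.edges, g ∈ S

/-- An edge set that catches no single edge outside of it is connected. -/
theorem EdgeSetConnected.of_doesNotCatch_singleton {V : Type*} {G : SimpleGraph V}
    {S : Set (Sym2 V)} (h : ∀ g ∈ G.edgeSet, g ∉ S → DoesNotCatch G S {g}) :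
    EdgeSetConnected G S := by
  intro e he f hf hef u v w hw hu hv hew hfw g hg
  by_contra hgS
  have hev := (h g (w.edges_subset_edgeSet hg) hgS).2 e he f hf hef u v w hw hu hv hew hfw
  classical
  have hcount : w.edges.countP
      (fun x => @decide (x ∈ ({g} : Set (Sym2 V))) (Classical.propDecidable _)) = 1 := by
    rw [← List.count_eq_one_of_mem hw.isTrail.edges_nodup hg, List.count]
    congr 1
    funext x
    by_cases hx : x = g <;> simp [hx]
  rw [hcount] at hev
  exact absurd hev (by decide)

/-- Under a friendly bijection, the coboundary of `P` has a connected image as soon as every edge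
avoiding `P` is a pendant edge whose leaf lies at even distance from `P`. -/
theorem FriendlyBij.edgeSetConnected_of_pendant {V₁ V₂ : Type*} {G₁ : SimpleGraph V₁}
    {G₂ : SimpleGraph V₂} {φ : G₁.edgeSet ≃ G₂.edgeSet} (hφ : FriendlyBij G₁ G₂ φ) (P : V₁)
    (h : ∀ e ∈ G₁.edgeSet, P ∉ e →
      ∃ Q, P ≠ Q ∧ Even (G₁.dist P Q) ∧ G₁.incidenceSet Q = {e}) :
    EdgeSetConnected G₂ (edgeImage φ (G₁.incidenceSet P)) := by
  refine .of_doesNotCatch_singleton fun g hg hgS => ?_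
  obtain ⟨⟨e, he⟩, hφe⟩ := φ.surjective ⟨g, hg⟩
  obtain ⟨Q, hPQ, hev, hQ⟩ := h e he fun hP => hgS ⟨⟨e, he⟩, ⟨he, hP⟩, by rw [hφe]⟩
  have himage : edgeImage φ (G₁.incidenceSet Q) = {g} := by
    ext x
    simp only [edgeImage, hQ, Set.mem_singleton_iff, Set.mem_ofPred_eq]
    constructor
    · rintro ⟨e₁, rfl, rfl⟩
      rw [hφe]
    · rintro rfl
      exact ⟨⟨e, he⟩, rfl, by rw [hφe]⟩
  exact himage ▸ (hφ P Q hPQ hev).1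

/-- A vertex `b` whose only neighbor is `a` lies at distance two from the other neighbors
of `a`, and its coboundary is the single edge `ab`. -/
theorem SimpleGraph.even_dist_and_incidenceSet_of_leaf {V : Type*} {G : SimpleGraph V}
    {P a b : V} (hPa : G.Adj P a) (hab : G.Adj a b) (hPb : P ≠ b)
    (hleaf : ∀ x, G.Adj b x → x = a) :
    Even (G.dist P b) ∧ G.incidenceSet b = {s(a, b)} := by
  constructor
  · have hle : G.dist P b ≤ 2 := dist_le (.cons hPa (.cons hab .nil))
    have h0 : G.dist P b ≠ 0 := fun h =>
      hPb ((Reachable.dist_eq_zero_iff ⟨.cons hPa (.cons hab .nil)⟩).1 h)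
    have h1 : G.dist P b ≠ 1 := fun h =>
      hPa.ne (hleaf P (dist_eq_one_iff_adj.1 h).symm)
    have : G.dist P b = 2 := by omega
    exact this ▸ even_two
  · ext e
    induction e using Sym2.ind with
    | _ x y =>
      simp only [mk'_mem_incidenceSet_iff, Set.mem_singleton_iff]
      constructor
      · rintro ⟨hxy, rfl | rfl⟩
        · rw [hleaf y hxy, Sym2.eq_swap]
        · rw [hleaf x hxy.symm]
      · intro h
        rcases Sym2.eq_iff.1 h with ⟨rfl, rfl⟩ | ⟨rfl, rfl⟩
        · exact ⟨hab, .inr rfl⟩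
        · exact ⟨hab.symm, .inl rfl⟩

/-- The coboundary of a vertex has a connected image under a friendly bijection if every edge
avoiding the vertex joins some neighbor of it to a leaf. -/
theorem FriendlyBij.edgeSetConnected_of_leaf {V₁ V₂ : Type*} {G₁ : SimpleGraph V₁}
    {G₂ : SimpleGraph V₂} {φ : G₁.edgeSet ≃ G₂.edgeSet} (hφ : FriendlyBij G₁ G₂ φ) {P a : V₁}
    (hPa : G₁.Adj P a)
    (h : ∀ x y, G₁.Adj x y → P ≠ x → P ≠ y →
      x = a ∧ (∀ z, G₁.Adj y z → z = a) ∨ y = a ∧ ∀ z, G₁.Adj x z → z = a) :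
    EdgeSetConnected G₂ (edgeImage φ (G₁.incidenceSet P)) := by
  refine hφ.edgeSetConnected_of_pendant P fun e he hPe => ?_
  induction e using Sym2.ind with
  | _ x y =>
    rw [Sym2.mem_iff, not_or] at hPe
    rcases h x y he hPe.1 hPe.2 with ⟨rfl, hy⟩ | ⟨rfl, hx⟩
    · exact ⟨y, hPe.2, even_dist_and_incidenceSet_of_leaf hPa he hPe.2 hy⟩
    · rw [Sym2.eq_swap]
      exact ⟨x, hPe.1, even_dist_and_incidenceSet_of_leaf hPa he.symm hPe.1 hx⟩

/-- **Statement.** Under a friendly bijection from `CB n₁ n₂` to a finite tree `G`, the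
images of the coboundaries of the two centers `C₁ = 0` and `C₂ = 1` are connected edge
sets of `G`. -/
theorem images_of_centers_connected {V : Type*} [Fintype V]
    (G : SimpleGraph V) (hT : G.IsTree)
    (n₁ n₂ : ℕ) (h₁ : 1 ≤ n₁) (h₂ : 1 ≤ n₂)
    (φ : (CB n₁ n₂).edgeSet ≃ G.edgeSet) (hφ : FriendlyBij (CB n₁ n₂) G φ) :
    EdgeSetConnected G
        (edgeImage φ ((CB n₁ n₂).incidenceSet ⟨0, by omega⟩)) ∧
      EdgeSetConnected G
        (edgeImage φ ((CB n₁ n₂).incidenceSet ⟨1, by omega⟩)) := by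
  have hadj : (CB n₁ n₂).Adj ⟨0, by omega⟩ ⟨1, by omega⟩ := by simp [CB]
  constructor
  · refine hφ.edgeSetConnected_of_leaf hadj ?_
    simp only [CB, fromRel_adj, ne_eq, Fin.ext_iff, Fin.forall_iff]
    grind
  · refine hφ.edgeSetConnected_of_leaf hadj.symm ?_
    simp only [CB, fromRel_adj, ne_eq, Fin.ext_iff, Fin.forall_iff]
    grind
end

section
/- Let G be a finite tree with at least 3 edges. Then one can choose two subsets E₁ and E₂ of E(G) intersecting in exactly one edge such that the subgraphs of G spanned by E₁ and by E₂ are connected, |E₁| = |E(G)| − 2, and |E₂| = 3. -/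
open SimpleGraph

namespace SpannedConnected

variable {V : Type*} {G : SimpleGraph V}

/-- An edge set is connected as soon as each of its vertices is joined to a fixed vertex. -/
lemma of_root {F : Set (Sym2 V)} (r : V)
    (h : ∀ x, (∃ e ∈ F, x ∈ e) → ∃ w : G.Walk x r, ∀ e ∈ w.edges, e ∈ F) :
    SpannedConnected G F := by
  intro x y hx hy
  obtain ⟨p, hp⟩ := h x hx
  obtain ⟨q, hq⟩ := h y hy
  refine ⟨p.append q.reverse, fun e he ↦ ?_⟩
  simp only [Walk.edges_append, Walk.edges_reverse, List.mem_append, List.mem_reverse] at he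
  exact he.elim (hp e) (hq e)

lemma singleton {u v : V} (huv : G.Adj u v) : SpannedConnected G {s(u, v)} := by
  refine of_root v fun x hx ↦ ?_
  obtain ⟨e, rfl, hx⟩ := hx
  rcases Sym2.mem_iff.mp hx with rfl | rfl
  · exact ⟨.cons huv .nil, by simp⟩
  · exact ⟨.nil, by simp⟩

/-- Adding an edge with an endpoint in a connected edge set keeps it connected. -/
lemma insert {F : Set (Sym2 V)} (hF : SpannedConnected G F) {e : Sym2 V} (he : e ∈ G.edgeSet)
    {u : V} (hue : u ∈ e) (hu : ∃ f ∈ F, u ∈ f) : SpannedConnected G (insert e F) := by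
  obtain ⟨v, rfl⟩ := Sym2.mem_iff_exists.mp hue
  refine of_root u fun x hx ↦ ?_
  obtain ⟨f, hf, hx⟩ := hx
  rcases hf with rfl | hf
  · rcases Sym2.mem_iff.mp hx with rfl | rfl
    · exact ⟨.nil, by simp⟩
    · exact ⟨.cons (G.adj_symm he) .nil, by simp [Sym2.eq_swap]⟩
  · obtain ⟨w, hw⟩ := hF x u ⟨f, hf, hx⟩ hu
    exact ⟨w, fun e he ↦ Or.inr (hw e he)⟩

end SpannedConnected

/-- A walk from a vertex touched by `A` to a vertex touched by `B`, where `A` and `B` cover all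
edges, meets a vertex touched by both. -/
lemma SimpleGraph.Walk.exists_mem_mem_of_edgeSet_subset_union {V : Type*} {G : SimpleGraph V}
    {A B : Set (Sym2 V)} (hAB : G.edgeSet ⊆ A ∪ B) {x y : V} (w : G.Walk x y)
    (hx : ∃ e ∈ A, x ∈ e) (hy : ∃ e ∈ B, y ∈ e) :
    ∃ z, (∃ e ∈ A, z ∈ e) ∧ ∃ e ∈ B, z ∈ e := by
  induction w with
  | nil => exact ⟨_, hx, hy⟩
  | cons h p ih =>
    rcases hAB (G.mem_edgeSet.mpr h) with hA | hB
    · exact ih ⟨_, hA, Sym2.mem_mk_right _ _⟩ hy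
    · exact ⟨_, hx, _, hB, Sym2.mem_mk_left _ _⟩

/-- The parent function `π` and depth function `δ` of a tree rooted at `r`. -/
lemma SimpleGraph.IsTree.exists_parent_depth {V : Type*} {G : SimpleGraph V} (hT : G.IsTree)
    (r : V) :
    ∃ (π : V → V) (δ : V → ℕ), δ r = 0 ∧ (∀ x, x ≠ r → G.Adj x (π x) ∧ δ x = δ (π x) + 1) ∧
      ∀ x y, G.Adj x y → (x ≠ r ∧ π x = y) ∨ (y ≠ r ∧ π y = x) := by
  choose f hf hu using fun x ↦ hT.existsUnique_path x r
  have hr : f r = .nil := (hu r .nil .nil).symm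
  have key (x y : V) (h : G.Adj x y) (hy : y ∈ (f x).support) : x ≠ r ∧ (f x).snd = y := by
    refine ⟨?_, (hT.isAcyclic.eq_snd_of_adj_start (hf x) h hy).symm⟩
    rintro rfl
    rw [hr] at hy
    exact h.ne (Walk.mem_support_nil_iff.mp hy).symm
  refine ⟨fun x ↦ (f x).snd, fun x ↦ (f x).length, by simp [hr], fun x hx ↦ ?_, fun x y h ↦ ?_⟩
  · have hn : ¬ (f x).Nil := Walk.not_nil_of_ne hx
    refine ⟨(f x).adj_snd hn, ?_⟩
    have := hu _ _ (hf x).tail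
    simp only [← this, Walk.length_tail_add_one hn]
  · by_cases hy : y ∈ (f x).support
    · exact .inl (key x y h hy)
    · refine .inr (key y x h.symm ?_)
      have := hT.isAcyclic.mem_support_of_ne_mem_support_of_adj_of_isPath (hf y).reverse
        (hf x).reverse h.symm (by simpa using hy)
      simpa using this

/-- In a finite tree with at least two edges one can remove two adjacent edges so that the
remaining edge set is connected. -/
lemma SimpleGraph.IsTree.exists_spannedConnected_diff_pair {V : Type*} [Finite V]
    {G : SimpleGraph V} (hT : G.IsTree) (h : G.edgeSet.Nontrivial) :
    ∃ e ∈ G.edgeSet, ∃ f ∈ G.edgeSet, e ≠ f ∧ (∃ c, c ∈ e ∧ c ∈ f) ∧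
      SpannedConnected G (G.edgeSet \ {e, f}) := by
  obtain ⟨r⟩ : Nonempty V := hT.connected.nonempty
  obtain ⟨π, δ, hr, hπ, hadj⟩ := hT.exists_parent_depth r
  have main (a b : V) (ha : a ≠ r) (hb : b ≠ r) (hab : a ≠ b)
      (hch : ∀ x, x ≠ r → (π x = a ∨ π x = b) → x = a ∨ x = b)
      (hc : ∃ c, c ∈ s(a, π a) ∧ c ∈ s(b, π b)) : ∃ e ∈ G.edgeSet, ∃ f ∈ G.edgeSet, e ≠ f ∧
        (∃ c, c ∈ e ∧ c ∈ f) ∧ SpannedConnected G (G.edgeSet \ {e, f}) := by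
    refine ⟨s(a, π a), (hπ a ha).1, s(b, π b), (hπ b hb).1, fun hef ↦ ?_, hc, ?_⟩
    · have h1 := (hπ a ha).2
      have h2 := (hπ b hb).2
      rcases Sym2.eq_iff.mp hef with ⟨h, -⟩ | ⟨h, h'⟩
      · exact hab h
      · rw [h'] at h1
        rw [← h] at h2
        omega
    have hmem (x : V) (hx : x ≠ r) (hxa : x ≠ a) (hxb : x ≠ b) :
        s(x, π x) ∈ G.edgeSet \ {s(a, π a), s(b, π b)} := by
      refine ⟨(hπ x hx).1, ?_⟩
      grind
    have hwalk (n : ℕ) : ∀ x, δ x = n → x ≠ a → x ≠ b →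
        ∃ w : G.Walk x r, ∀ e ∈ w.edges, e ∈ G.edgeSet \ {s(a, π a), s(b, π b)} := by
      induction n with
      | zero =>
        intro x hx _ _
        obtain rfl : x = r := by
          by_contra hxr
          have := (hπ x hxr).2
          omega
        exact ⟨.nil, by simp⟩
      | succ n ih =>
        intro x hx hxa hxb
        have hxr : x ≠ r := by
          rintro rfl
          omega
        obtain ⟨hx1, hx2⟩ := hπ x hxr
        obtain ⟨w, hw⟩ := ih (π x) (by omega) (by grind) (by grind)
        refine ⟨.cons hx1 w, fun e he ↦ ?_⟩
        rw [Walk.edges_cons, List.mem_cons] at he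
        rcases he with rfl | he
        · exact hmem x hxr hxa hxb
        · exact hw e he
    refine SpannedConnected.of_root r fun x hx ↦ ?_
    obtain ⟨e, ⟨heG, heab⟩, hxe⟩ := hx
    obtain ⟨y, rfl⟩ := Sym2.mem_iff_exists.mp hxe
    have hxy := hadj x y heG
    refine hwalk _ x rfl ?_ ?_ <;> grind
  have : Nonempty V := ⟨r⟩
  obtain ⟨v, hv⟩ := Finite.exists_max δ
  have hvr : v ≠ r := by
    rintro rfl
    obtain ⟨e, he⟩ := h.nonempty
    induction e with | _ x y
    have := hv x
    have := hv y
    rcases hadj x y he with ⟨hx, -⟩ | ⟨hx, -⟩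
    · have := (hπ x hx).2
      omega
    · have := (hπ y hx).2
      omega
  have hv1 := (hπ v hvr).2
  by_cases hw : ∃ w, w ≠ v ∧ w ≠ r ∧ π w = π v
  · obtain ⟨w, hwv, hwr, hwπ⟩ := hw
    have hw1 := (hπ w hwr).2
    refine main v w hvr hwr hwv.symm (fun x hx hxp ↦ ?_) ⟨π v, by simp, by simp [hwπ]⟩
    have := (hπ x hx).2
    have := hv x
    rw [hwπ] at hw1
    rcases hxp with h | h <;> grind
  · push Not at hw
    have hvr' : π v ≠ r := by
      intro hvr'
      have hall (x : V) (hx : x ≠ r) : x = v := by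
        by_contra hxv
        have h1 := (hπ x hx).2
        have h2 := hv x
        have h3 := hw x hxv hx
        rw [hvr'] at h3 hv1
        have := (hπ _ h3).2
        omega
      obtain ⟨e, he, f, hf, hef⟩ := h
      have heq (e : Sym2 V) (he : e ∈ G.edgeSet) : e = s(v, r) := by
        induction e with | _ x y
        rcases hadj x y he with ⟨hx, rfl⟩ | ⟨hx, rfl⟩
        · rw [hall x hx, hvr']
        · rw [hall y hx, hvr', Sym2.eq_swap]
      exact hef ((heq e he).trans (heq f hf).symm)
    refine main v (π v) hvr hvr' (hπ v hvr).1.ne (fun x hx hxp ↦ ?_) ⟨π v, by simp, by simp⟩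
    rcases hxp with h | h
    · have h1 := (hπ x hx).2
      have h2 := hv x
      rw [h] at h1
      omega
    · exact .inl (by_contra fun hxv ↦ hw x hxv hx h)

/-- **Lemma.** In a finite tree `G` with at least 3 edges one can choose connected edge
sets `E₁`, `E₂` meeting in exactly one edge with `|E₁| = |E(G)| - 2` and `|E₂| = 3`. -/
theorem exists_split_3 {V : Type*} [Fintype V] [DecidableEq V]
    (G : SimpleGraph V) [DecidableRel G.Adj] (hT : G.IsTree)
    (h : 3 ≤ G.edgeFinset.card) :
    ∃ E₁ E₂ : Finset (Sym2 V), ↑E₁ ⊆ G.edgeSet ∧ ↑E₂ ⊆ G.edgeSet ∧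
      (E₁ ∩ E₂).card = 1 ∧ E₁.card = G.edgeFinset.card - 2 ∧ E₂.card = 3 ∧
      SpannedConnected G ↑E₁ ∧ SpannedConnected G ↑E₂ := by
  have hnt : G.edgeSet.Nontrivial := by
    rw [← coe_edgeFinset]
    exact Finset.one_lt_card_iff_nontrivial.mp (by omega)
  obtain ⟨e, he, f, hf, hef, ⟨c, hce, hcf⟩, hconn⟩ := hT.exists_spannedConnected_diff_pair hnt
  have hcard : (G.edgeFinset \ {e, f}).card = G.edgeFinset.card - 2 := by
    rw [Finset.card_sdiff_of_subset, Finset.card_pair hef]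
    simp [Finset.insert_subset_iff, he, hf]
  obtain ⟨g₀, hg₀⟩ := Finset.card_pos.mp (show 0 < (G.edgeFinset \ {e, f}).card by omega)
  obtain ⟨y, z, rfl⟩ : ∃ y z, g₀ = s(y, z) := by
    induction g₀ with | _ y z
    exact ⟨y, z, rfl⟩
  obtain ⟨w⟩ := hT.connected.preconnected c y
  obtain ⟨u, hu, g, ⟨hgG, hgef⟩, hug⟩ := w.exists_mem_mem_of_edgeSet_subset_union
    (A := {e, f}) (B := G.edgeSet \ {e, f}) (by simp)
    ⟨e, by simp, hce⟩ ⟨_, by simpa using hg₀, Sym2.mem_mk_left _ _⟩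
  have hef' : SpannedConnected G {e, f} := by
    obtain ⟨d, rfl⟩ := Sym2.mem_iff_exists.mp hcf
    exact (SpannedConnected.singleton hf).insert he hce ⟨_, rfl, hcf⟩
  have hge : g ≠ e := fun h ↦ hgef (by simp [h])
  have hgf : g ≠ f := fun h ↦ hgef (by simp [h])
  refine ⟨G.edgeFinset \ {e, f}, {g, e, f}, ?_, ?_, ?_, hcard,
    Finset.card_eq_three.mpr ⟨g, e, f, hge, hgf, hef, rfl⟩, by simpa using hconn,
    by simpa using hef'.insert hgG hug hu⟩
  · simp
  · simp [Set.insert_subset_iff, he, hf, hgG]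
  · rw [Finset.card_eq_one]
    refine ⟨g, ?_⟩
    ext x
    have := mem_edgeFinset.mpr hgG
    simp only [Finset.mem_inter, Finset.mem_sdiff, Finset.mem_insert, Finset.mem_singleton]
    grind
end

section
/- Let G be a finite tree with at least 4 edges. Then one can choose two subsets E₁ and E₂ of E(G) intersecting in exactly one edge such that the subgraphs of G spanned by E₁ and by E₂ are connected, |E₁| = |E(G)| − 3, and |E₂| = 4. -/
open SimpleGraph

/-- In a connected graph every vertex other than `r` can be sent to a neighbour which is one step
closer to `r`. -/
lemma SimpleGraph.Connected.exists_parent {V : Type*} {G : SimpleGraph V} (hG : G.Connected)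
    (r : V) : ∃ par : V → V, ∀ a, a ≠ r →
      G.Adj a (par a) ∧ G.dist (par a) r + 1 = G.dist a r := by
  have key : ∀ a, ∃ b, a ≠ r → G.Adj a b ∧ G.dist b r + 1 = G.dist a r := by
    intro a
    by_cases ha : a = r
    · exact ⟨a, fun h => absurd ha h⟩
    obtain ⟨p, hp⟩ := hG.exists_walk_length_eq_dist a r
    cases p with
    | nil => exact absurd rfl ha
    | @cons _ b _ hab q =>
      refine ⟨b, fun _ => ⟨hab, ?_⟩⟩
      have h1 := SimpleGraph.dist_le q
      have h2 := hG.dist_triangle (u := a) (v := b) (w := r)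
      have h3 : G.dist a b = 1 := SimpleGraph.dist_eq_one_iff_adj.mpr hab
      simp only [SimpleGraph.Walk.length_cons] at hp
      lia
  choose par hpar using key
  exact ⟨par, hpar⟩

section Parent

variable {V : Type*} {r : V} {par : V → V} {d : V → ℕ}

/-- The map sending a vertex to its parent edge is injective away from the root. -/
lemma parentEdge_injOn (hd : ∀ a, a ≠ r → d (par a) + 1 = d a) :
    Set.InjOn (fun a => s(a, par a)) {a | a ≠ r} := by
  intro a ha b hb hab
  rcases Sym2.eq_iff.mp hab with h | h
  · exact h.1
  · have h1 := hd a ha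
    have h2 := hd b hb
    rw [h.2] at h1
    rw [← h.1] at h2
    lia

/-- A set of parent edges is connected when following parents inside the set always ends at a
fixed vertex `t`. -/
lemma spannedConnected_parentEdges [DecidableEq V] {G : SimpleGraph V}
    (hadj : ∀ a, a ≠ r → G.Adj a (par a))
    (hd : ∀ a, a ≠ r → d (par a) + 1 = d a) {Y : Finset V} (hr : r ∉ Y) {t : V}
    (ht : ∀ y ∈ Y, par y = t ∨ par y ∈ Y) :
    SpannedConnected G ↑(Y.image fun a => s(a, par a)) := by
  have key : ∀ n x, d x = n → (x = t ∨ x ∈ Y) →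
      ∃ w : G.Walk x t, ∀ e ∈ w.edges, e ∈ Y.image fun a => s(a, par a) := by
    intro n
    induction n using Nat.strong_induction_on with
    | _ n ih =>
      intro x hx h
      by_cases hxt : x = t
      · subst hxt
        exact ⟨.nil, by simp⟩
      · have hxY := h.resolve_left hxt
        have hxr : x ≠ r := fun h => hr (h ▸ hxY)
        obtain ⟨w, hw⟩ := ih (d (par x)) (by have := hd x hxr; lia) (par x) rfl (ht x hxY)
        refine ⟨.cons (hadj x hxr) w, fun e he => ?_⟩
        rw [SimpleGraph.Walk.edges_cons, List.mem_cons] at he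
        rcases he with rfl | he
        · exact Finset.mem_image_of_mem _ hxY
        · exact hw e he
  have cover : ∀ x, (∃ e ∈ (↑(Y.image fun a => s(a, par a)) : Set (Sym2 V)), x ∈ e) →
      x = t ∨ x ∈ Y := by
    rintro x ⟨e, he, hxe⟩
    obtain ⟨y, hy, rfl⟩ := Finset.mem_image.mp (Finset.mem_coe.mp he)
    rcases Sym2.mem_iff.mp hxe with rfl | rfl
    · exact .inr hy
    · exact ht y hy
  intro x y hx hy
  obtain ⟨p, hp⟩ := key _ x rfl (cover x hx)
  obtain ⟨q, hq⟩ := key _ y rfl (cover y hy)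
  refine ⟨p.append q.reverse, fun e he => ?_⟩
  rw [SimpleGraph.Walk.edges_append, SimpleGraph.Walk.edges_reverse, List.mem_append,
    List.mem_reverse] at he
  exact Finset.mem_coe.mpr (he.elim (hp e) (hq e))

/-- A set containing the root and closed under taking children contains everything. -/
lemma mem_of_children_closed (hd : ∀ a, a ≠ r → d (par a) + 1 = d a) {Z : Finset V}
    (hr : r ∈ Z) (hZ : ∀ a, a ≠ r → par a ∈ Z → a ∈ Z) (a : V) : a ∈ Z := by
  induction h : d a using Nat.strong_induction_on generalizing a with
  | _ n ih =>
    by_cases ha : a = r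
    · exact ha ▸ hr
    · exact hZ a ha (ih (d (par a)) (by have := hd a ha; lia) (par a) rfl)

variable [Fintype V] [DecidableEq V]

/-- A children-closed set `X` of three vertices whose parent edges are connected through a vertex
outside `X` can be enlarged by one vertex, keeping the parent edges connected. -/
lemma exists_insert_connected (hd : ∀ a, a ≠ r → d (par a) + 1 = d a)
    (hcard : 5 ≤ Fintype.card V) {X : Finset V} (hX : X.card = 3) (hr : r ∉ X)
    (hclosed : ∀ a, a ≠ r → par a ∈ X → a ∈ X) {t : V} (htX : t ∉ X)
    (ht : ∀ x ∈ X, par x = t ∨ par x ∈ X) :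
    ∃ z, z ∉ X ∧ z ≠ r ∧ ∃ t, ∀ y ∈ insert z X, par y = t ∨ par y ∈ insert z X := by
  by_cases htr : t = r
  · subst htr
    by_contra! hcon
    have hall := mem_of_children_closed hd (Finset.mem_insert_self t X) (by
      intro a ha hpa
      rcases Finset.mem_insert.mp hpa with h | h
      · by_contra haX
        obtain ⟨y, hy, hy1, hy2⟩ := hcon a (by grind) ha t
        grind
      · exact Finset.mem_insert_of_mem (hclosed a ha h))
    have h1 : (Finset.univ : Finset V).card ≤ (insert t X).card :=
      Finset.card_le_card fun a _ => hall a
    have h2 := Finset.card_insert_le t X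
    rw [Finset.card_univ] at h1
    lia
  · exact ⟨t, htX, htr, par t, by grind⟩

/-- In a rooted tree with at least five vertices there are a children-closed set `X` of three
non-root vertices and a further non-root vertex `z` such that the parent edges of `insert z X`
are connected. -/
lemma exists_children_closed (hr : d r = 0) (hd : ∀ a, a ≠ r → d (par a) + 1 = d a)
    (hcard : 5 ≤ Fintype.card V) :
    ∃ X : Finset V, X.card = 3 ∧ r ∉ X ∧ (∀ a, a ≠ r → par a ∈ X → a ∈ X) ∧
      ∃ z, z ∉ X ∧ z ≠ r ∧ ∃ t, ∀ y ∈ insert z X, par y = t ∨ par y ∈ insert z X := by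
  have small : ∀ a b c : V, ¬ ∀ x, x = a ∨ x = b ∨ x = c := by
    intro a b c h
    have h1 : (Finset.univ : Finset V).card ≤ ({a, b, c} : Finset V).card :=
      Finset.card_le_card fun x _ => by simpa using h x
    have h2 : ({a, b, c} : Finset V).card ≤ 3 := Finset.card_le_three
    rw [Finset.card_univ] at h1
    lia
  have closed : ∀ a b c : V, (r = a ∨ r = b ∨ r = c) →
      ∃ x, x ≠ r ∧ (par x = a ∨ par x = b ∨ par x = c) ∧ x ≠ a ∧ x ≠ b ∧ x ≠ c := by
    intro a b c h
    by_contra! hcon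
    refine small a b c fun x => ?_
    have := mem_of_children_closed hd (Z := {a, b, c}) (by simpa using h)
      (by intro y hy hp; simp only [Finset.mem_insert, Finset.mem_singleton] at hp ⊢; grind) x
    simpa using this
  have extend : ∀ a b c t : V, a ≠ b → a ≠ c → b ≠ c → a ≠ r → b ≠ r → c ≠ r →
      t ≠ a → t ≠ b → t ≠ c →
      (∀ x, x ≠ r → (par x = a ∨ par x = b ∨ par x = c) → x = a ∨ x = b ∨ x = c) →
      (∀ x, (x = a ∨ x = b ∨ x = c) → par x = t ∨ par x = a ∨ par x = b ∨ par x = c) →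
      ∃ X : Finset V, X.card = 3 ∧ r ∉ X ∧ (∀ a, a ≠ r → par a ∈ X → a ∈ X) ∧
        ∃ z, z ∉ X ∧ z ≠ r ∧ ∃ t, ∀ y ∈ insert z X, par y = t ∨ par y ∈ insert z X := by
    intro a b c t hab hac hbc ha hb hc hta htb htc hcl hpar
    have h1 : ({a, b, c} : Finset V).card = 3 :=
      Finset.card_eq_three.mpr ⟨a, b, c, hab, hac, hbc, rfl⟩
    have h2 : r ∉ ({a, b, c} : Finset V) := by simp [ha.symm, hb.symm, hc.symm]
    have h3 : ∀ x, x ≠ r → par x ∈ ({a, b, c} : Finset V) → x ∈ ({a, b, c} : Finset V) := by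
      simpa using hcl
    exact ⟨{a, b, c}, h1, h2, h3, exists_insert_connected hd hcard h1 h2 h3 (t := t)
      (by simp [hta, htb, htc]) (by simpa using hpar)⟩
  obtain ⟨v, -, hmax⟩ := Finset.exists_max_image Finset.univ d ⟨r, Finset.mem_univ r⟩
  replace hmax : ∀ x, d x ≤ d v := fun x => hmax x (Finset.mem_univ x)
  have leaf : ∀ x y, d x = d v → y ≠ r → par y ≠ x := by
    rintro x y hx hy rfl
    have := hd y hy
    have := hmax y
    lia
  have hvr : v ≠ r := by
    rintro rfl
    obtain ⟨x, hx, -⟩ := closed v v v (by simp)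
    have := hd x hx
    have := hmax x
    lia
  -- Two siblings at maximal depth.
  by_cases two : ∃ a b, a ≠ b ∧ a ≠ r ∧ b ≠ r ∧ d a = d v ∧ par a = par b
  · obtain ⟨a, b, hab, ha, hb, hda, hp⟩ := two
    have hda' := hd a ha
    have hdb' := hd b hb
    rw [← hp] at hdb'
    by_cases three : ∃ c, c ≠ a ∧ c ≠ b ∧ c ≠ r ∧ par c = par a
    · obtain ⟨c, hca, hcb, hc, hpc⟩ := three
      have hdc' := hd c hc
      rw [hpc] at hdc'
      apply extend a b c (par a) hab hca.symm hcb.symm ha hb hc <;> grind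
    · push Not at three
      have hur : par a ≠ r := by
        intro hur
        obtain ⟨x, hx, h1, h2⟩ := closed r a b (by simp)
        grind
      have hdu := hd (par a) hur
      apply extend a b (par a) (par (par a)) hab _ _ ha hb hur <;> grind
  · push Not at two
    have hdv := hd v hvr
    have hur : par v ≠ r := by
      intro hur
      obtain ⟨x, hx, h1, h2⟩ := closed r v v (by simp)
      grind
    have hdu := hd (par v) hur
    by_cases sib : ∃ w, w ≠ par v ∧ w ≠ r ∧ par w = par (par v)
    · obtain ⟨w, hwu, hw, hpw⟩ := sib
      have hdw := hd w hw
      rw [hpw] at hdw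
      by_cases child : ∃ x, x ≠ r ∧ par x = w
      · obtain ⟨x, hx, hpx⟩ := child
        have hdx := hd x hx
        rw [hpx] at hdx
        refine ⟨{v, par v, x}, Finset.card_eq_three.mpr ⟨v, par v, x, ?_, ?_, ?_, rfl⟩, ?_, ?_,
          w, ?_, hw, par (par v), ?_⟩ <;> grind
      · push Not at child
        apply extend v (par v) w (par (par v)) _ _ hwu.symm hvr hur hw <;> grind
    · push Not at sib
      have h2r : par (par v) ≠ r := by
        intro h2r
        obtain ⟨x, hx, h1, h2⟩ := closed r (par v) v (by simp)
        grind
      have hd2 := hd _ h2r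
      apply extend v (par v) (par (par v)) (par (par (par v))) _ _ _ hvr hur h2r <;> grind

end Parent

/-- **Lemma.** In a finite tree `G` with at least 4 edges one can choose connected edge
sets `E₁`, `E₂` meeting in exactly one edge with `|E₁| = |E(G)| - 3` and `|E₂| = 4`. -/
theorem exists_split_4 {V : Type*} [Fintype V] [DecidableEq V]
    (G : SimpleGraph V) [DecidableRel G.Adj] (hT : G.IsTree)
    (h : 4 ≤ G.edgeFinset.card) :
    ∃ E₁ E₂ : Finset (Sym2 V), ↑E₁ ⊆ G.edgeSet ∧ ↑E₂ ⊆ G.edgeSet ∧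
      (E₁ ∩ E₂).card = 1 ∧ E₁.card = G.edgeFinset.card - 3 ∧ E₂.card = 4 ∧
      SpannedConnected G ↑E₁ ∧ SpannedConnected G ↑E₂ := by
  obtain ⟨r⟩ := hT.connected.nonempty
  obtain ⟨par, hpar⟩ := hT.connected.exists_parent r
  have hcard := hT.card_edgeFinset
  have hadj : ∀ a, a ≠ r → G.Adj a (par a) := fun a ha => (hpar a ha).1
  have hd : ∀ a, a ≠ r → G.dist (par a) r + 1 = G.dist a r := fun a ha => (hpar a ha).2
  obtain ⟨X, hX, hrX, hclosed, z, hzX, hzr, t, ht⟩ :=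
    exists_children_closed (d := fun a => G.dist a r) SimpleGraph.dist_self hd (by lia)
  have hinj := parentEdge_injOn (d := fun a => G.dist a r) hd
  have hrY : r ∉ insert z X := by simp [hzr.symm, hrX]
  have hrZ : r ∉ (insert r X)ᶜ := by simp
  have sub : ∀ {Y : Finset V}, r ∉ Y → (↑Y : Set V) ⊆ {a | a ≠ r} :=
    fun hY a ha h => hY (h ▸ ha)
  have edges : ∀ {Y : Finset V}, r ∉ Y →
      (↑(Y.image fun a => s(a, par a)) : Set (Sym2 V)) ⊆ G.edgeSet := by
    intro Y hY e he
    obtain ⟨a, ha, rfl⟩ := Finset.mem_image.mp (Finset.mem_coe.mp he)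
    exact hadj a (sub hY ha)
  refine ⟨(insert r X)ᶜ.image fun a => s(a, par a), (insert z X).image fun a => s(a, par a),
    edges hrZ, edges hrY, ?_, ?_, ?_,
    spannedConnected_parentEdges (d := fun a => G.dist a r) hadj hd hrZ (t := r) ?_,
    spannedConnected_parentEdges (d := fun a => G.dist a r) hadj hd hrY ht⟩
  · have hinter : (insert r X)ᶜ ∩ insert z X = {z} := by
      ext a
      simp only [Finset.mem_inter, Finset.mem_compl, Finset.mem_insert, Finset.mem_singleton]
      grind
    rw [← Finset.image_inter_of_injOn _ _ (hinj.mono (Set.union_subset (sub hrZ) (sub hrY))),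
      hinter, Finset.image_singleton, Finset.card_singleton]
  · rw [Finset.card_image_of_injOn (hinj.mono (sub hrZ)), Finset.card_compl,
      Finset.card_insert_of_notMem hrX]
    lia
  · rw [Finset.card_image_of_injOn (hinj.mono (sub hrY)), Finset.card_insert_of_notMem hzX, hX]
  · intro y hy
    simp only [Finset.mem_compl, Finset.mem_insert, not_or] at hy ⊢
    by_cases h : par y = r
    · exact .inl h
    · exact .inr ⟨h, fun hp => hy.2 (hclosed y hy.1 hp)⟩
end

section
/- For every n ≥ 1, the tree CB(n,2) is friendly to every finite tree with n+1 edges. -/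
open SimpleGraph

namespace DoesNotCatch

variable {V : Type*} {G : SimpleGraph V} {p q : Set (Sym2 V)}

/-- Parity is automatic when no path between two edges of `p` meets `q`. -/
theorem of_forall_notMem (hpq : Disjoint p q)
    (h : ∀ e ∈ p, ∀ f ∈ p, e ≠ f → ∀ (u v : V) (w : G.Walk u v), w.IsPath → u ∈ e → v ∈ f →
      e ∉ w.edges → f ∉ w.edges → ∀ x ∈ w.edges, x ∉ q) :
    DoesNotCatch G p q := by
  refine ⟨hpq.inter_eq, fun e he f hf hne u v w hw hu hv hew hfw ↦ ?_⟩
  rw [List.countP_eq_zero.2 fun x hx ↦ by simpa using h e he f hf hne u v w hw hu hv hew hfw x hx]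
  exact Even.zero

theorem of_subsingleton (hpq : Disjoint p q) (hp : p.Subsingleton) : DoesNotCatch G p q :=
  of_forall_notMem hpq fun _ he _ hf hne ↦ absurd (hp he hf) hne

/-- Two adjacent edges of an acyclic graph have a trivial connecting path. -/
theorem of_subset_pair (hG : G.IsAcyclic) (hpq : Disjoint p q) {x y z : V}
    (hxy : G.Adj x y) (hxz : G.Adj x z) (hp : p ⊆ {s(x, y), s(x, z)}) : DoesNotCatch G p q := by
  classical
  refine of_forall_notMem hpq ?_
  have key : ∀ {a b : V}, G.Adj x a → G.Adj x b → a ≠ b → ∀ (u v : V) (w : G.Walk u v), w.IsPath →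
      u ∈ s(x, a) → v ∈ s(x, b) → s(x, a) ∉ w.edges → s(x, b) ∉ w.edges → w.edges = [] := by
    intro a b ha hb hab u v w hw hu hv hew hfw
    have uniq (w' : G.Walk u v) (hw' : w'.IsPath) : w = w' :=
      congrArg Subtype.val ((hG.subsingleton_path u v).elim ⟨w, hw⟩ ⟨w', hw'⟩)
    rcases Sym2.mem_iff.1 hu with rfl | rfl <;> rcases Sym2.mem_iff.1 hv with rfl | rfl
    · simp [uniq .nil .nil]
    · simp [uniq hb.toWalk (by simp [hb.ne])] at hfw
    · simp [uniq ha.symm.toWalk (by simp [ha.ne']), Sym2.eq_swap] at hew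
    · simp [uniq (.cons ha.symm hb.toWalk) (by simp [hb.ne, ha.ne', hab]), Sym2.eq_swap] at hew
  intro e he f hf hne u v w hw hu hv hew hfw
  suffices w.edges = [] by simp [this]
  rcases hp he with rfl | rfl <;> rcases hp hf with rfl | rfl
  · exact absurd rfl hne
  · exact key hxy hxz (by rintro rfl; exact hne rfl) u v w hw hu hv hew hfw
  · exact key hxz hxy (by rintro rfl; exact hne rfl) u v w hw hu hv hew hfw
  · exact absurd rfl hne

end DoesNotCatch

namespace SimpleGraph

variable {V : Type*} {G : SimpleGraph V}

/-- A tree on at least three vertices has a leaf whose neighbour has another neighbour. -/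
theorem IsTree.exists_leaf_adj_adj [Fintype V] (hG : G.IsTree) (hV : 2 < Fintype.card V) :
    ∃ l x y, G.Adj x l ∧ G.Adj x y ∧ y ≠ l ∧ (G.neighborSet l).Subsingleton := by
  classical
  have : Nontrivial V := Fintype.one_lt_card_iff_nontrivial.1 (by lia)
  obtain ⟨l, hl⟩ := hG.exists_vert_degree_one_of_nontrivial
  obtain ⟨x, hlx, huniq⟩ := degree_eq_one_iff_existsUnique_adj.1 hl
  have hsub : (G.neighborSet l).Subsingleton :=
    fun a ha b hb ↦ (huniq a ha).trans (huniq b hb).symm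
  obtain ⟨z, -, hz⟩ := Finset.exists_mem_notMem_of_card_lt_card
    (s := {l, x}) (t := Finset.univ) ((Finset.card_le_two).trans_lt (by simpa using hV))
  obtain ⟨hzl, hzx⟩ : z ≠ l ∧ z ≠ x := by simpa using hz
  obtain ⟨w, hw⟩ := hG.connected.exists_isPath x z
  cases w with
  | nil => exact absurd rfl hzx
  | @cons _ y _ h p =>
    refine ⟨l, x, y, hlx.symm, h, ?_, hsub⟩
    rintro rfl
    exact hw.isTrail.not_mem_support_of_subsingleton_neighborSet hlx.ne hzl.symm hsub (by simp)

end SimpleGraph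

/-- The edge at a leaf is not caught by any set of other edges. -/
theorem DoesNotCatch.of_leaf {V : Type*} {G : SimpleGraph V} {p q : Set (Sym2 V)} {l x : V}
    (hl : (G.neighborSet l).Subsingleton) (hlx : G.Adj x l) (hpq : Disjoint p q)
    (hp : p ⊆ G.edgeSet) (hlp : s(x, l) ∉ p) (hq : q ⊆ {s(x, l)}) : DoesNotCatch G p q := by
  have hne : ∀ e ∈ p, ∀ u ∈ e, u ≠ l := by
    rintro e he u hu rfl
    obtain ⟨b, rfl⟩ := Sym2.mem_iff_exists.1 hu
    have hb : G.Adj u b := hp he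
    rw [hl hb hlx.symm, Sym2.eq_swap] at he
    exact hlp he
  refine of_forall_notMem hpq fun e he f hf _ u v w hw hu hv _ _ d hd hdq ↦ ?_
  obtain rfl : d = s(x, l) := hq hdq
  exact hw.isTrail.not_mem_support_of_subsingleton_neighborSet (hne e he u hu).symm
    (hne f hf v hv).symm hl (w.snd_mem_support_of_mem_edges hd)

theorem CB_two_adj {n : ℕ} (hn : 1 ≤ n) {a b : Fin (n + 2)} :
    (CB n 2).Adj a b ↔
      (a.val = 0 ∧ 1 ≤ b.val ∧ b.val ≤ n) ∨ (b.val = 0 ∧ 1 ≤ a.val ∧ a.val ≤ n) ∨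
      (a.val = 1 ∧ b.val = n + 1) ∨ (b.val = 1 ∧ a.val = n + 1) := by
  have := a.isLt
  have := b.isLt
  simp only [CB, fromRel_adj, ne_eq, Fin.ext_iff]
  lia

theorem CB_two_card_edgeSet {n : ℕ} (hn : 1 ≤ n) : Nat.card (CB n 2).edgeSet = n + 1 := by
  let par (i : Fin (n + 1)) : Fin (n + 2) := if i.val = n then 1 else 0
  have hpar (i) : (par i).val = if i.val = n then 1 else 0 := by
    simp only [par]; split <;> simp
  let f (i : Fin (n + 1)) : (CB n 2).edgeSet := ⟨s(par i, i.succ), by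
    rw [mem_edgeSet, CB_two_adj hn, hpar, Fin.val_succ]
    split <;> lia⟩
  have hf : Function.Bijective f := by
    constructor
    · intro i j hij
      have h : s(par i, i.succ) = s(par j, j.succ) := congrArg Subtype.val hij
      simp only [Sym2.eq_iff, Fin.ext_iff, hpar, Fin.val_succ] at h
      ext
      split_ifs at h <;> lia
    · rintro ⟨e, he⟩
      induction e with | _ a b
      have hab := (CB_two_adj hn).1 ((CB n 2).mem_edgeSet.1 he)
      have : ∃ i : Fin (n + 1), s(par i, i.succ) = s(a, b) := by
        simp only [Sym2.eq_iff, Fin.ext_iff, hpar, Fin.val_succ]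
        rcases hab with h | h | h | h
        · exact ⟨⟨b - 1, by lia⟩, by grind⟩
        · exact ⟨⟨a - 1, by lia⟩, by grind⟩
        · exact ⟨⟨n, by lia⟩, by simp [h]⟩
        · exact ⟨⟨n, by lia⟩, by simp [h]⟩
      exact this.imp fun i hi ↦ Subtype.ext hi
  simpa using (Nat.card_eq_of_bijective f hf).symm

/-- A bijection between equinumerous types can be chosen with two prescribed values. -/
theorem exists_equiv_apply_eq_apply_eq {α β : Type*} (e : α ≃ β) {a a' : α} {b b' : β}
    (ha : a ≠ a') (hb : b ≠ b') : ∃ φ : α ≃ β, φ a = b ∧ φ a' = b' := by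
  classical
  let e₁ := e.trans (Equiv.swap (e a) b)
  have h₁ : e₁ a = b := by simp [e₁]
  have h₂ : e₁ a' ≠ b := fun h ↦ ha (e₁.injective (h₁.trans h.symm))
  exact ⟨e₁.trans (Equiv.swap (e₁ a') b'), by
    simp [h₁, Equiv.swap_apply_of_ne_of_ne h₂.symm hb], by simp⟩

theorem edgeImage_subset_edgeSet {V₁ V₂ : Type*} {G₁ : SimpleGraph V₁} {G₂ : SimpleGraph V₂}
    (φ : G₁.edgeSet → G₂.edgeSet) (s : Set (Sym2 V₁)) : edgeImage φ s ⊆ G₂.edgeSet := by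
  rintro _ ⟨e, -, rfl⟩
  exact (φ e).2

theorem disjoint_edgeImage {V₁ V₂ : Type*} {G₁ : SimpleGraph V₁} {G₂ : SimpleGraph V₂}
    {φ : G₁.edgeSet → G₂.edgeSet} (hφ : φ.Injective) {s t : Set (Sym2 V₁)} (h : Disjoint s t) :
    Disjoint (edgeImage φ s) (edgeImage φ t) := by
  rw [Set.disjoint_left]
  rintro _ ⟨e, he, rfl⟩ ⟨f, hf, hfe⟩
  obtain rfl := hφ (Subtype.ext hfe)
  exact Set.disjoint_left.1 h he hf

/-- For every `n ≥ 1`, the tree `CB n 2` is friendly to every finite tree with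
`n + 1` edges. -/
theorem cb_n_2_friendly {V : Type*} [Fintype V] [DecidableEq V]
    (G : SimpleGraph V) [DecidableRel G.Adj] (hT : G.IsTree)
    (n : ℕ) (hn : 1 ≤ n) (hE : G.edgeFinset.card = n + 1) :
    Friendly (CB n 2) G := by
  have hV := hT.card_edgeFinset
  obtain ⟨l, x, y, hxl, hxy, hyl, hl⟩ := hT.exists_leaf_adj_adj (by lia)
  have hcd : (CB n 2).Adj 0 1 := (CB_two_adj hn).2 (by simp [hn])
  have hdd : (CB n 2).Adj 1 (Fin.last (n + 1)) := (CB_two_adj hn).2 (by simp)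
  let c : (CB n 2).edgeSet := ⟨s(0, 1), hcd⟩
  let d : (CB n 2).edgeSet := ⟨s(1, Fin.last (n + 1)), hdd⟩
  have hlast : ∀ e : (CB n 2).edgeSet, Fin.last (n + 1) ∈ e.1 → e = d := by
    rintro ⟨e, he⟩ h
    obtain ⟨b, rfl⟩ := Sym2.mem_iff_exists.1 h
    have := (CB_two_adj hn).1 he
    have hb : b = 1 := by ext; simp at this ⊢; lia
    exact Subtype.ext (by simp [d, hb, Sym2.eq_swap])
  have hone : ∀ e : (CB n 2).edgeSet, 1 ∈ e.1 → e = c ∨ e = d := by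
    rintro ⟨e, he⟩ h
    obtain ⟨b, rfl⟩ := Sym2.mem_iff_exists.1 h
    have := (CB_two_adj hn).1 he
    have hb : b = 0 ∨ b = Fin.last (n + 1) := by
      simp only [Fin.ext_iff, Fin.val_zero, Fin.val_one, Fin.val_last] at this ⊢
      lia
    rcases hb with rfl | rfl
    · exact .inl (Subtype.ext Sym2.eq_swap)
    · exact .inr rfl
  have hleaf : ∀ P : Fin (n + 2), 2 ≤ P.val → ∀ e f : (CB n 2).edgeSet,
      P ∈ e.1 → P ∈ f.1 → e = f := by
    rintro P hP ⟨e, he⟩ ⟨f, hf⟩ h h'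
    obtain ⟨a, rfl⟩ := Sym2.mem_iff_exists.1 h
    obtain ⟨b, rfl⟩ := Sym2.mem_iff_exists.1 h'
    have := (CB_two_adj hn).1 he
    have := (CB_two_adj hn).1 hf
    have hab : a = b := by ext; lia
    subst hab
    rfl
  have hcard : Nat.card (CB n 2).edgeSet = Nat.card G.edgeSet := by
    rw [CB_two_card_edgeSet hn, ← hE, Nat.card_eq_fintype_card, edgeFinset_card]
  have hcdne : c ≠ d := by
    intro h
    have := congrArg Subtype.val h
    simp [c, d, Fin.ext_iff] at this
  obtain ⟨φ, hφc, hφd⟩ := exists_equiv_apply_eq_apply_eq (Finite.card_eq.1 hcard).some hcdne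
    (b := (⟨s(x, y), hxy⟩ : G.edgeSet)) (b' := ⟨s(x, l), hxl⟩)
    (by simpa [Subtype.ext_iff, hyl] using fun _ h ↦ absurd h hxy.ne')
  have key : ∀ P Q : Fin (n + 2), P ≠ Q → ¬ (CB n 2).Adj P Q →
      DoesNotCatch G (edgeImage φ ((CB n 2).incidenceSet P))
        (edgeImage φ ((CB n 2).incidenceSet Q)) := by
    intro P Q hPQ hadj
    have hdisj := disjoint_edgeImage φ.injective
      (Set.disjoint_iff_inter_eq_empty.2 (incidenceSet_inter_incidenceSet_of_not_adj _ hadj hPQ))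
    rcases (by lia : P.val = 0 ∨ P.val = 1 ∨ 2 ≤ P.val) with h | h | h
    · obtain rfl : P = 0 := Fin.ext h
      obtain rfl : Q = Fin.last (n + 1) := by
        rw [CB_two_adj hn] at hadj
        ext
        simp only [ne_eq, Fin.ext_iff, Fin.val_zero, Fin.val_last] at hadj hPQ ⊢
        lia
      refine .of_leaf hl hxl hdisj (edgeImage_subset_edgeSet _ _) ?_ ?_
      · rintro ⟨e, he, hed⟩
        obtain rfl : e = d := φ.injective (hφd ▸ Subtype.ext hed)
        have := he.2
        simp [d, Fin.ext_iff] at this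
      · rintro _ ⟨e, he, rfl⟩
        simp [hlast e he.2, hφd]
    · obtain rfl : P = 1 := Fin.ext h
      refine .of_subset_pair hT.isAcyclic hdisj hxy hxl ?_
      rintro _ ⟨e, he, rfl⟩
      rcases hone e he.2 with rfl | rfl <;> simp [hφc, hφd]
    · refine .of_subsingleton hdisj ?_
      rintro _ ⟨e, he, rfl⟩ _ ⟨f, hf, rfl⟩
      rw [hleaf P h e f he.2 hf.2]
  refine ⟨φ, fun P Q hPQ heven ↦ ?_⟩
  have hadj : ¬ (CB n 2).Adj P Q := fun h ↦ by
    rw [dist_eq_one_iff_adj.2 h] at heven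
    exact absurd heven (by decide)
  exact ⟨key P Q hPQ hadj, key Q P hPQ.symm fun h ↦ hadj h.symm⟩
end

section
/- For every n ≥ 1, the tree CB(n,3) is friendly to every finite tree with n+2 edges. -/
open SimpleGraph

namespace SimpleGraph

variable {V : Type*} {G : SimpleGraph V}

lemma Connected.exists_adj_of_card_lt [Fintype V] (hG : G.Connected) {S : Finset V}
    (hS : S.Nonempty) (hcard : S.card < Fintype.card V) :
    ∃ u ∈ S, ∃ v ∉ S, G.Adj u v := by
  obtain ⟨a, ha⟩ := hS
  obtain ⟨b, hb⟩ : ∃ b, b ∉ S := by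
    by_contra! h
    exact hcard.ne (Finset.card_eq_iff_eq_univ S |>.2 (Finset.eq_univ_iff_forall.2 h))
  obtain ⟨w⟩ := hG a b
  obtain ⟨d, -, h₁, h₂⟩ := w.exists_boundary_dart (S : Set V) (by simpa using ha) (by simpa using hb)
  exact ⟨d.fst, by simpa using h₁, d.snd, by simpa using h₂, d.adj⟩

lemma Walk.IsPath.exists_two_edges_of_mem_support {u v c : V} {w : G.Walk u v} (hw : w.IsPath)
    (hc : c ∈ w.support) (hu : c ≠ u) (hv : c ≠ v) :
    ∃ y z, y ≠ z ∧ s(c, y) ∈ w.edges ∧ s(c, z) ∈ w.edges := by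
  classical
  have h₁ := Walk.mk_penultimate_end_mem_edges (p := w.takeUntil c hc)
    (Walk.not_nil_of_ne hu.symm)
  have h₂ := Walk.mk_start_snd_mem_edges (p := w.dropUntil c hc) (Walk.not_nil_of_ne hv)
  rw [Sym2.eq_swap] at h₁
  refine ⟨_, _, fun h => ?_, w.edges_takeUntil_subset_edges hc h₁,
    w.edges_dropUntil_subset_edges hc h₂⟩
  rw [h] at h₁
  exact hw.isTrail.disjoint_edges_takeUntil_dropUntil hc h₁ h₂

/-- A path between edges other than the pendant edge `s(x, c)` avoids that edge. -/
lemma Walk.IsPath.pendant_notMem_edges {x c u v : V} (hx : ∀ y, G.Adj x y ↔ y = c)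
    {w : G.Walk u v} (hw : w.IsPath) {e f : Sym2 V} (he : e ∈ G.edgeSet) (hf : f ∈ G.edgeSet)
    (hne : e ≠ s(x, c)) (hnf : f ≠ s(x, c)) (hu : u ∈ e) (hv : v ∈ f) :
    s(x, c) ∉ w.edges := by
  intro h
  have key : ∀ g ∈ G.edgeSet, g ≠ s(x, c) → x ∉ g := by
    rintro g hg hne ⟨y, rfl⟩
    exact hne (by rw [(hx y).1 hg])
  obtain ⟨y, z, hyz, hy, hz⟩ := hw.exists_two_edges_of_mem_support
    (w.fst_mem_support_of_mem_edges h)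
    (fun h => key e he hne (h ▸ hu)) (fun h => key f hf hnf (h ▸ hv))
  exact hyz (((hx y).1 (w.adj_of_mem_edges hy)).trans ((hx z).1 (w.adj_of_mem_edges hz)).symm)

/-- If `c` has only the neighbours `x` and `d`, with `x` a leaf, a path between edges not incident
to `c` avoids `s(c, d)`. -/
lemma Walk.IsPath.subpendant_notMem_edges {x c d u v : V} (hx : ∀ y, G.Adj x y ↔ y = c)
    (hc : ∀ y, G.Adj c y ↔ y = x ∨ y = d)
    {w : G.Walk u v} (hw : w.IsPath) {e f : Sym2 V} (he : e ∈ G.edgeSet) (hf : f ∈ G.edgeSet)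
    (hne : e ≠ s(x, c)) (hne' : e ≠ s(c, d)) (hnf : f ≠ s(x, c)) (hnf' : f ≠ s(c, d))
    (hu : u ∈ e) (hv : v ∈ f) :
    s(c, d) ∉ w.edges := by
  intro h
  have key : ∀ g ∈ G.edgeSet, g ≠ s(x, c) → g ≠ s(c, d) → c ∉ g := by
    rintro g hg h₁ h₂ ⟨y, rfl⟩
    rcases (hc y).1 hg with rfl | rfl
    · exact h₁ Sym2.eq_swap
    · exact h₂ rfl
  obtain ⟨y, z, hyz, hy, hz⟩ := hw.exists_two_edges_of_mem_support
    (w.fst_mem_support_of_mem_edges h)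
    (fun h => key e he hne hne' (h ▸ hu)) (fun h => key f hf hnf hnf' (h ▸ hv))
  have hxc := hw.pendant_notMem_edges hx he hf hne hnf hu hv
  rw [Sym2.eq_swap] at hxc
  rcases (hc y).1 (w.adj_of_mem_edges hy) with rfl | rfl
  · exact hxc hy
  · rcases (hc z).1 (w.adj_of_mem_edges hz) with rfl | rfl
    · exact hxc hz
    · exact hyz rfl

lemma IsAcyclic.edges_subset (hG : G.IsAcyclic) {u v : V} {w : G.Walk u v} (hw : w.IsPath)
    (w' : G.Walk u v) : w.edges ⊆ w'.edges := by
  classical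
  have h : w = w'.bypass :=
    congrArg Subtype.val ((hG.subsingleton_path u v).elim ⟨w, hw⟩ ⟨w'.bypass, w'.bypass_isPath⟩)
  rw [h]
  exact w'.edges_bypass_subset_edges

/-- A set of edges joined to a vertex `c` by walks inside the set contains all paths between its
edges. -/
lemma IsAcyclic.edges_subset_of_walk (hG : G.IsAcyclic) {T : Set (Sym2 V)} {c : V}
    (hT : ∀ e ∈ T, ∀ u ∈ e, ∃ w : G.Walk u c, ∀ g ∈ w.edges, g ∈ T)
    {e f : Sym2 V} (he : e ∈ T) (hf : f ∈ T) {u v : V} (hu : u ∈ e) (hv : v ∈ f)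
    {w : G.Walk u v} (hw : w.IsPath) : ∀ g ∈ w.edges, g ∈ T := by
  intro g hg
  obtain ⟨w₁, h₁⟩ := hT e he u hu
  obtain ⟨w₂, h₂⟩ := hT f hf v hv
  have := hG.edges_subset hw (w₁.append w₂.reverse) hg
  simp only [Walk.edges_append, Walk.edges_reverse, List.mem_append, List.mem_reverse] at this
  exact this.elim (h₁ g) (h₂ g)

/-- A tree with at least four vertices has two leaves with a common neighbour, or a leaf whose
neighbour has degree two. -/
lemma IsTree.exists_leaf_pair_or_subpendant [Fintype V] (hG : G.IsTree)
    (hcard : 4 ≤ Fintype.card V) :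
    ∃ x c d, d ≠ x ∧ (∀ y, G.Adj x y ↔ y = c) ∧
      ((∀ y, G.Adj d y ↔ y = c) ∨ ∀ y, G.Adj c y ↔ y = x ∨ y = d) := by
  classical
  have : Nonempty V := hG.connected.nonempty
  obtain ⟨x, v, p, hp, hmax⟩ := Walk.exists_isPath_forall_isPath_length_le_length G
  cases p with
  | nil =>
    obtain ⟨a, -, b, -, hab⟩ := hG.connected.exists_adj_of_card_lt (S := {x}) (by simp)
      (by simp; omega)
    simpa using hmax _ _ _ hab.isPath_toWalk
  | @cons _ c _ hxc q =>
    obtain ⟨hq, hxq⟩ := (Walk.cons_isPath_iff _ _).1 hp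
    have leaf : ∀ x', G.Adj x' c → x' ∉ q.support → ∀ y, G.Adj x' y ↔ y = c := by
      intro x' hx' hxq' y
      refine ⟨fun hy => ?_, fun hy => hy ▸ hx'⟩
      have hp' : (Walk.cons hx' q).IsPath := hq.cons hxq'
      by_contra hyc
      by_cases hmem : y ∈ (Walk.cons hx' q).support
      · exact hyc (by simpa using hG.isAcyclic.eq_snd_of_adj_start hp' hy hmem)
      · have := hmax _ _ _ (hp'.cons (h := hy.symm) hmem)
        simp at this
    have hx := leaf x hxc hxq
    obtain ⟨a, ha, d, hd, had⟩ := hG.connected.exists_adj_of_card_lt (S := {x, c}) (by simp)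
      (lt_of_le_of_lt Finset.card_le_two (by omega))
    simp only [Finset.mem_insert, Finset.mem_singleton, not_or] at ha hd
    obtain rfl : a = c := by
      rcases ha with rfl | rfl
      · exact absurd ((hx d).1 had) hd.2
      · rfl
    by_cases hleaf : ∃ d', d' ≠ x ∧ G.Adj d' a ∧ d' ∉ q.support
    · obtain ⟨d', h₁, h₂, h₃⟩ := hleaf
      exact ⟨x, a, d', h₁, hx, Or.inl (leaf d' h₂ h₃)⟩
    · push Not at hleaf
      have snd : ∀ y, y ≠ x → G.Adj a y → y = q.snd := fun y hy h =>
        hG.isAcyclic.eq_snd_of_adj_start hq h (hleaf y hy h.symm)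
      refine ⟨x, a, d, hd.1, hx, Or.inr fun y => ⟨fun h => ?_, ?_⟩⟩
      · by_cases hy : y = x
        · exact Or.inl hy
        · exact Or.inr ((snd y hy h).trans (snd d hd.1 had).symm)
      · rintro (rfl | rfl)
        · exact hxc.symm
        · exact had

/-- Three edges `b₁`, `b₂`, `e` of a tree such that all remaining edges lie on one side of `b₁` and
on one side of `b₂`, and such that `{b₁, b₂, e}` is connected. -/
lemma IsTree.exists_peripheral_triple [Fintype V] (hG : G.IsTree)
    (hcard : 4 ≤ Fintype.card V) :
    ∃ b₁ ∈ G.edgeSet, ∃ b₂ ∈ G.edgeSet, ∃ e ∈ G.edgeSet, b₁ ≠ b₂ ∧ b₁ ≠ e ∧ b₂ ≠ e ∧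
      (∀ f ∈ G.edgeSet, f ≠ b₁ → f ≠ b₂ → ∀ g ∈ G.edgeSet, g ≠ b₁ → g ≠ b₂ →
        ∀ (u v : V) (w : G.Walk u v), w.IsPath → u ∈ f → v ∈ g →
          b₁ ∉ w.edges ∧ b₂ ∉ w.edges) ∧
      (∀ f ∈ ({b₁, b₂, e} : Set (Sym2 V)), ∀ g ∈ ({b₁, b₂, e} : Set (Sym2 V)),
        ∀ (u v : V) (w : G.Walk u v), w.IsPath → u ∈ f → v ∈ g →
          ∀ k ∈ w.edges, k ∈ ({b₁, b₂, e} : Set (Sym2 V))) := by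
  classical
  obtain ⟨x, c, d, hdx, hx, h⟩ := hG.exists_leaf_pair_or_subpendant hcard
  obtain ⟨a, ha, z, hz, haz⟩ := hG.connected.exists_adj_of_card_lt (S := {x, c, d}) (by simp)
    (lt_of_le_of_lt Finset.card_le_three (by omega))
  simp only [Finset.mem_insert, Finset.mem_singleton, not_or] at ha hz
  obtain ⟨hzx, hzc, hzd⟩ := hz
  have hxc : G.Adj x c := (hx c).2 rfl
  rcases h with hd | hc
  · have hdc : G.Adj d c := (hd c).2 rfl
    obtain rfl : a = c := by
      rcases ha with rfl | rfl | rfl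
      · exact absurd ((hx z).1 haz) hzc
      · rfl
      · exact absurd ((hd z).1 haz) hzc
    refine ⟨s(x, a), hxc, s(d, a), hdc, s(a, z), haz, by grind, by grind, by grind,
      fun f hf hf₁ hf₂ g hg hg₁ hg₂ u v w hw hu hv =>
        ⟨hw.pendant_notMem_edges hx hf hg hf₁ hg₁ hu hv,
          hw.pendant_notMem_edges hd hf hg hf₂ hg₂ hu hv⟩,
      fun f hf g hg u v w hw hu hv =>
        hG.isAcyclic.edges_subset_of_walk (c := a) ?_ hf hg hu hv hw⟩
    rintro k (rfl | rfl | rfl) u hu <;> rcases Sym2.mem_iff.1 hu with rfl | rfl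
    · exact ⟨hxc.toWalk, by simp⟩
    · exact ⟨.nil, by simp⟩
    · exact ⟨hdc.toWalk, by simp⟩
    · exact ⟨.nil, by simp⟩
    · exact ⟨.nil, by simp⟩
    · exact ⟨haz.symm.toWalk, by simp [Sym2.eq_swap]⟩
  · have hcd : G.Adj c d := (hc d).2 (Or.inr rfl)
    obtain rfl : a = d := by
      rcases ha with rfl | rfl | rfl
      · exact absurd ((hx z).1 haz) hzc
      · exact absurd ((hc z).1 haz) (by simp [hzx, hzd])
      · rfl
    refine ⟨s(x, c), hxc, s(c, a), hcd, s(a, z), haz, by grind, by grind, by grind,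
      fun f hf hf₁ hf₂ g hg hg₁ hg₂ u v w hw hu hv =>
        ⟨hw.pendant_notMem_edges hx hf hg hf₁ hg₁ hu hv,
          hw.subpendant_notMem_edges hx hc hf hg hf₁ hf₂ hg₁ hg₂ hu hv⟩,
      fun f hf g hg u v w hw hu hv =>
        hG.isAcyclic.edges_subset_of_walk (c := a) ?_ hf hg hu hv hw⟩
    rintro k (rfl | rfl | rfl) u hu <;> rcases Sym2.mem_iff.1 hu with rfl | rfl
    · exact ⟨.cons hxc hcd.toWalk, by simp⟩
    · exact ⟨hcd.toWalk, by simp⟩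
    · exact ⟨hcd.toWalk, by simp⟩
    · exact ⟨.nil, by simp⟩
    · exact ⟨.nil, by simp⟩
    · exact ⟨haz.symm.toWalk, by simp [Sym2.eq_swap]⟩

end SimpleGraph

lemma CB_three_adj_iff {n : ℕ} (hn : 1 ≤ n) {a b : Fin (n + 3)} :
    (CB n 3).Adj a b ↔
      ((a.val = 0 ∧ b.val = 1) ∨ (a.val = 0 ∧ 2 ≤ b.val ∧ b.val ≤ n) ∨
        (a.val = 1 ∧ n + 1 ≤ b.val)) ∨
      ((b.val = 0 ∧ a.val = 1) ∨ (b.val = 0 ∧ 2 ≤ a.val ∧ a.val ≤ n) ∨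
        (b.val = 1 ∧ n + 1 ≤ a.val)) := by
  rw [CB, SimpleGraph.fromRel_adj, and_iff_right_iff_imp]
  rintro h rfl
  omega

lemma exists_equiv_three_apply_eq {α β : Type*} [Finite α] [Finite β]
    (hcard : Nat.card α = Nat.card β) {x₁ x₂ x₃ : α} (hx₁₂ : x₁ ≠ x₂) (hx₁₃ : x₁ ≠ x₃)
    (hx₂₃ : x₂ ≠ x₃) {y₁ y₂ y₃ : β} (hy₁₂ : y₁ ≠ y₂) (hy₁₃ : y₁ ≠ y₃) (hy₂₃ : y₂ ≠ y₃) :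
    ∃ φ : α ≃ β, φ x₁ = y₁ ∧ φ x₂ = y₂ ∧ φ x₃ = y₃ := by
  classical
  obtain ⟨φ⟩ : Nonempty (α ≃ β) := Finite.card_eq.1 hcard
  let φ₁ := φ.trans (Equiv.swap (φ x₁) y₁)
  let φ₂ := φ₁.trans (Equiv.swap (φ₁ x₂) y₂)
  have h₁ : φ₁ x₁ = y₁ := Equiv.swap_apply_left _ _
  have h₂₁ : φ₂ x₁ = y₁ := by
    change Equiv.swap (φ₁ x₂) y₂ (φ₁ x₁) = y₁
    rw [Equiv.swap_apply_of_ne_of_ne (φ₁.injective.ne hx₁₂) (by rwa [h₁]), h₁]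
  have h₂ : φ₂ x₂ = y₂ := Equiv.swap_apply_left _ _
  refine ⟨φ₂.trans (Equiv.swap (φ₂ x₃) y₃), ?_, ?_, Equiv.swap_apply_left _ _⟩
  · rw [Equiv.trans_apply, Equiv.swap_apply_of_ne_of_ne (φ₂.injective.ne hx₁₃) (by rwa [h₂₁]), h₂₁]
  · rw [Equiv.trans_apply, Equiv.swap_apply_of_ne_of_ne (φ₂.injective.ne hx₂₃) (by rwa [h₂]), h₂]

/-- The edges of `CB n 3` correspond to its vertices other than `0`, each giving the edge towards
its neighbouring center. -/
lemma card_CB_three_edgeSet {n : ℕ} (hn : 1 ≤ n) : Nat.card (CB n 3).edgeSet = n + 2 := by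
  have hadj : ∀ i : Fin (n + 2), (CB n 3).Adj
      ⟨if i.val + 1 ≤ n then 0 else 1, by split_ifs <;> omega⟩ ⟨i.val + 1, by omega⟩ := by
    intro i
    rw [CB_three_adj_iff hn]
    dsimp only
    split_ifs <;> omega
  have hbij : Function.Bijective (fun i : Fin (n + 2) =>
      (⟨s(_, _), hadj i⟩ : (CB n 3).edgeSet)) := by
    constructor
    · intro i j hij
      simp only [Subtype.ext_iff, Sym2.eq_iff, Fin.ext_iff] at hij
      apply Fin.ext
      grind
    · rintro ⟨e, he⟩
      induction e using Sym2.ind with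
      | _ a b =>
        have hab := (CB_three_adj_iff hn).1 ((CB n 3).mem_edgeSet.1 he)
        wlog hlt : a.val < b.val generalizing a b
        · have hba := ((CB n 3).mem_edgeSet.1 he).symm
          obtain ⟨i, hi⟩ := this b a hba ((CB_three_adj_iff hn).1 hba) (by omega)
          exact ⟨i, hi.trans (Subtype.ext Sym2.eq_swap)⟩
        refine ⟨⟨b.val - 1, by omega⟩, ?_⟩
        simp only [Subtype.ext_iff, Sym2.eq_iff, Fin.ext_iff]
        left
        split_ifs <;> omega
  rw [← Nat.card_congr (Equiv.ofBijective _ hbij), Nat.card_eq_fintype_card, Fintype.card_fin]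

/-- A bijection of the edge sets of `CB n 3` and `G` that sends the three edges at the center of
degree `3` to a triple as in `SimpleGraph.IsTree.exists_peripheral_triple` is friendly. -/
lemma friendlyBij_CB_three {V : Type*} {G : SimpleGraph V} {n : ℕ} (hn : 1 ≤ n)
    (φ : (CB n 3).edgeSet ≃ G.edgeSet) {B₁ B₂ E : (CB n 3).edgeSet}
    (hB₁ : (B₁ : Sym2 (Fin (n + 3))) = s(⟨1, by omega⟩, ⟨n + 1, by omega⟩))
    (hB₂ : (B₂ : Sym2 (Fin (n + 3))) = s(⟨1, by omega⟩, ⟨n + 2, by omega⟩))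
    (hE : (E : Sym2 (Fin (n + 3))) = s(⟨0, by omega⟩, ⟨1, by omega⟩))
    (hside : ∀ f ∈ G.edgeSet, f ≠ φ B₁ → f ≠ φ B₂ → ∀ g ∈ G.edgeSet, g ≠ φ B₁ → g ≠ φ B₂ →
        ∀ (u v : V) (w : G.Walk u v), w.IsPath → u ∈ f → v ∈ g →
          (φ B₁ : Sym2 V) ∉ w.edges ∧ (φ B₂ : Sym2 V) ∉ w.edges)
    (hconn : ∀ f ∈ ({↑(φ B₁), ↑(φ B₂), ↑(φ E)} : Set (Sym2 V)),
        ∀ g ∈ ({↑(φ B₁), ↑(φ B₂), ↑(φ E)} : Set (Sym2 V)),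
        ∀ (u v : V) (w : G.Walk u v), w.IsPath → u ∈ f → v ∈ g →
          ∀ k ∈ w.edges, k ∈ ({↑(φ B₁), ↑(φ B₂), ↑(φ E)} : Set (Sym2 V))) :
    FriendlyBij (CB n 3) G φ := by
  have leaf : ∀ P : Fin (n + 3), 2 ≤ P.val → ∀ e ∈ (CB n 3).incidenceSet P,
      e = s(⟨if P.val ≤ n then 0 else 1, by split_ifs <;> omega⟩, P) := by
    rintro P hP _ ⟨he, y, rfl⟩
    have := (CB_three_adj_iff hn).1 ((CB n 3).mem_edgeSet.1 he)
    rw [Sym2.eq_swap, Sym2.eq_iff]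
    left
    simp only [Fin.ext_iff, and_true]
    split_ifs <;> omega
  have mem_center : ∀ P : Fin (n + 3), P.val = 1 → ∀ e : (CB n 3).edgeSet,
      (e : Sym2 _) ∈ (CB n 3).incidenceSet P ↔ e = B₁ ∨ e = B₂ ∨ e = E := by
    intro P hP e
    constructor
    · rintro ⟨he, y, hy⟩
      rw [hy] at he
      have := (CB_three_adj_iff hn).1 ((CB n 3).mem_edgeSet.1 he)
      simp only [Subtype.ext_iff, hB₁, hB₂, hE, hy, Sym2.eq_iff, Fin.ext_iff]
      omega
    · rintro (rfl | rfl | rfl)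
      · exact ⟨e.2, by simp [hB₁, Fin.ext_iff, hP]⟩
      · exact ⟨e.2, by simp [hB₂, Fin.ext_iff, hP]⟩
      · exact ⟨e.2, by simp [hE, Fin.ext_iff, hP]⟩
  have image_center : ∀ P : Fin (n + 3), P.val = 1 → ∀ e : (CB n 3).edgeSet,
      (φ e : Sym2 V) ∈ ({↑(φ B₁), ↑(φ B₂), ↑(φ E)} : Set (Sym2 V)) ↔
      (e : Sym2 _) ∈ (CB n 3).incidenceSet P := by
    intro P hP e
    simp [mem_center P hP, Subtype.coe_inj]
  have key : ∀ P Q : Fin (n + 3), P ≠ Q → ¬ (CB n 3).Adj P Q →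
      DoesNotCatch G (edgeImage φ ((CB n 3).incidenceSet P))
        (edgeImage φ ((CB n 3).incidenceSet Q)) := by
    intro P Q hPQ hadj
    have hdisj : ∀ e ∈ (CB n 3).incidenceSet P, e ∉ (CB n 3).incidenceSet Q := fun e h₁ h₂ =>
      (SimpleGraph.incidenceSet_inter_incidenceSet_of_not_adj _ hadj hPQ).le ⟨h₁, h₂⟩
    refine ⟨Set.eq_empty_iff_forall_notMem.2 ?_, ?_⟩
    · rintro _ ⟨⟨e, he, rfl⟩, f, hf, hfe⟩
      rw [Subtype.coe_inj, φ.apply_eq_iff_eq] at hfe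
      exact hdisj e he (hfe ▸ hf)
    rintro _ ⟨e, he, rfl⟩ _ ⟨f, hf, rfl⟩ hne u v w hw hu hv - -
    suffices h : ∀ k ∈ w.edges, k ∉ edgeImage φ ((CB n 3).incidenceSet Q) by
      rw [List.countP_eq_zero.2 (by simpa using h)]
      exact Even.zero
    have hP : P.val = 0 ∨ P.val = 1 := by
      by_contra hP
      refine hne (congrArg _ (congrArg _ (Subtype.ext ?_)))
      rw [leaf P (by omega) _ he, leaf P (by omega) _ hf]
    rintro _ hk ⟨k, hkQ, rfl⟩
    rcases hP with hP | hP
    · have hQ : n + 1 ≤ Q.val := by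
        rw [CB_three_adj_iff hn] at hadj
        have := Fin.val_ne_of_ne hPQ
        grind
      have ne_of : ∀ g : (CB n 3).edgeSet, (g : Sym2 _) ∈ (CB n 3).incidenceSet P →
          (φ g : Sym2 V) ≠ φ B₁ ∧ (φ g : Sym2 V) ≠ φ B₂ := by
        intro g hg
        simp only [Ne, Subtype.coe_inj, φ.apply_eq_iff_eq]
        constructor
        · rintro rfl
          have := hg.2
          simp only [hB₁, Sym2.mem_iff, Fin.ext_iff] at this
          omega
        · rintro rfl
          have := hg.2
          simp only [hB₂, Sym2.mem_iff, Fin.ext_iff] at this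
          omega
      obtain ⟨h₁, h₂⟩ := hside _ (φ e).2 (ne_of e he).1 (ne_of e he).2 _ (φ f).2 (ne_of f hf).1
        (ne_of f hf).2 u v w hw hu hv
      have hkB : k = B₁ ∨ k = B₂ := by
        simp only [Subtype.ext_iff, hB₁, hB₂, leaf Q (by omega) _ hkQ, Sym2.eq_iff, Fin.ext_iff]
        split_ifs <;> omega
      rcases hkB with rfl | rfl
      · exact h₁ hk
      · exact h₂ hk
    · have image_center := image_center P hP
      exact hdisj k ((image_center k).1 (hconn _ ((image_center e).2 he) _ ((image_center f).2 hf)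
        u v w hw hu hv _ hk)) hkQ
  intro P Q hPQ heven
  have hadj : ¬ (CB n 3).Adj P Q := fun h => by
    rw [SimpleGraph.dist_eq_one_iff_adj.2 h] at heven
    exact absurd heven (by decide)
  exact ⟨key P Q hPQ hadj, key Q P hPQ.symm fun h => hadj h.symm⟩

/-- For every `n ≥ 1`, the tree `CB n 3` is friendly to every finite tree with
`n + 2` edges. -/
theorem cb_n_3_friendly {V : Type*} [Fintype V] [DecidableEq V]
    (G : SimpleGraph V) [DecidableRel G.Adj] (hT : G.IsTree)
    (n : ℕ) (hn : 1 ≤ n) (hE : G.edgeFinset.card = n + 2) :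
    Friendly (CB n 3) G := by
  have hcard := hT.card_edgeFinset
  obtain ⟨b₁, hb₁, b₂, hb₂, e, he, h₁₂, h₁, h₂, hside, hconn⟩ :=
    hT.exists_peripheral_triple (by omega)
  obtain ⟨B₁, hB₁⟩ : ∃ B : (CB n 3).edgeSet,
      (B : Sym2 (Fin (n + 3))) = s(⟨1, by omega⟩, ⟨n + 1, by omega⟩) :=
    ⟨⟨s(⟨1, by omega⟩, ⟨n + 1, by omega⟩), (CB n 3).mem_edgeSet.2
      ((CB_three_adj_iff hn).2 (by dsimp only; omega))⟩, rfl⟩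
  obtain ⟨B₂, hB₂⟩ : ∃ B : (CB n 3).edgeSet,
      (B : Sym2 (Fin (n + 3))) = s(⟨1, by omega⟩, ⟨n + 2, by omega⟩) :=
    ⟨⟨s(⟨1, by omega⟩, ⟨n + 2, by omega⟩), (CB n 3).mem_edgeSet.2
      ((CB_three_adj_iff hn).2 (by dsimp only; omega))⟩, rfl⟩
  obtain ⟨E, hE₀⟩ : ∃ B : (CB n 3).edgeSet,
      (B : Sym2 (Fin (n + 3))) = s(⟨0, by omega⟩, ⟨1, by omega⟩) :=
    ⟨⟨s(⟨0, by omega⟩, ⟨1, by omega⟩), (CB n 3).mem_edgeSet.2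
      ((CB_three_adj_iff hn).2 (by dsimp only; omega))⟩, rfl⟩
  have hB₁₂ : B₁ ≠ B₂ := by
    simp only [Ne, Subtype.ext_iff, hB₁, hB₂, Sym2.eq_iff, Fin.ext_iff]
    omega
  have hB₁E : B₁ ≠ E := by
    simp only [Ne, Subtype.ext_iff, hB₁, hE₀, Sym2.eq_iff, Fin.ext_iff]
    omega
  have hB₂E : B₂ ≠ E := by
    simp only [Ne, Subtype.ext_iff, hB₂, hE₀, Sym2.eq_iff, Fin.ext_iff]
    omega
  have hcardE : Nat.card (CB n 3).edgeSet = Nat.card G.edgeSet := by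
    rw [card_CB_three_edgeSet hn, ← hE, SimpleGraph.edgeFinset_card, Nat.card_eq_fintype_card]
  obtain ⟨φ, hφ₁, hφ₂, hφe⟩ := exists_equiv_three_apply_eq hcardE hB₁₂ hB₁E hB₂E
    (y₁ := ⟨b₁, hb₁⟩) (y₂ := ⟨b₂, hb₂⟩) (y₃ := ⟨e, he⟩)
    (by simpa using h₁₂) (by simpa using h₁) (by simpa using h₂)
  refine ⟨φ, friendlyBij_CB_three hn φ hB₁ hB₂ hE₀ ?_ ?_⟩
  · rwa [hφ₁, hφ₂]
  · rwa [hφ₁, hφ₂, hφe]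
end
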